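/- arXiv:1704.04271 — 6 statements merged into one kernel-verified Lean document; each statement's English description precedes it below -/
import Mathlib

section
/- Let n be a natural number and let Sⁿ denote the unit sphere {x ∈ ℝ^{n+1} : ‖x‖ = 1}. If f : Sⁿ → Sⁿ is a continuous map such that f(−x) ≠ f(x) for every x ∈ Sⁿ, then f is surjective. -/
theorem Polynomial.Monic.exists_isRoot_of_odd_natDegree {p : Polynomial ℝ} (hp : p.Monic)
    (hodd : Odd p.natDegree) : ∃ x, p.IsRoot x := by
  have hpos : 0 < p.natDegree := hodd.pos
  have htop := p.tendsto_atTop_of_leadingCoeff_nonneg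
    (Polynomial.natDegree_pos_iff_degree_pos.mp hpos) (by simp [hp.leadingCoeff])
  have hdeg : (p.comp (-Polynomial.X)).natDegree = p.natDegree := by
    simp [Polynomial.natDegree_comp]
  have hbot := (p.comp (-Polynomial.X)).tendsto_atBot_of_leadingCoeff_nonpos
    (Polynomial.natDegree_pos_iff_degree_pos.mp (hdeg ▸ hpos))
    (by rw [Polynomial.leadingCoeff_comp (by simp)]; simp [hp.leadingCoeff, hodd.neg_one_pow])
  obtain ⟨a, ha⟩ := (htop.eventually_ge_atTop 0).exists
  obtain ⟨b, hb⟩ := (hbot.eventually_le_atBot 0).exists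
  exact mem_range_of_exists_le_of_exists_ge p.continuous ⟨-b, by simpa using hb⟩ ⟨a, ha⟩

theorem Module.End.exists_hasEigenvalue_of_odd_finrank {V : Type*} [AddCommGroup V] [Module ℝ V]
    [FiniteDimensional ℝ V] (hodd : Odd (Module.finrank ℝ V)) (T : Module.End ℝ V) :
    ∃ c, T.HasEigenvalue c := by
  obtain ⟨c, hc⟩ := (LinearMap.charpoly_monic T).exists_isRoot_of_odd_natDegree
    (by rwa [LinearMap.charpoly_natDegree])
  exact ⟨c, (Module.End.hasEigenvalue_iff_isRoot_charpoly T c).mpr hc⟩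

/-- A commutative real algebra acting on an odd-dimensional space has a common eigenvector. -/
theorem exists_common_eigenvector_of_odd_finrank {A V : Type*} [CommRing A] [Algebra ℝ A]
    [AddCommGroup V] [Module ℝ V] [Module A V] [IsScalarTower ℝ A V] [FiniteDimensional ℝ V]
    (hodd : Odd (Module.finrank ℝ V)) :
    ∃ v : V, v ≠ 0 ∧ ∀ a : A, ∃ c : ℝ, a • v = c • v := by
  have hfin (W : Submodule A V) : FiniteDimensional ℝ W :=
    FiniteDimensional.of_injective (W.subtype.restrictScalars ℝ) W.injective_subtype
  have hex : ∃ k, ∃ W : Submodule A V, Module.finrank ℝ W = k ∧ Odd k :=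
    ⟨_, ⊤, ((Submodule.topEquiv (R := A) (M := V)).restrictScalars ℝ).finrank_eq, hodd⟩
  classical
  obtain ⟨W, hW, hWodd⟩ := Nat.find_spec hex
  have hmin (U : Submodule A W) (hU : Odd (Module.finrank ℝ U)) : U = ⊤ := by
    have h₁ : Module.finrank ℝ (U.map W.subtype) = Module.finrank ℝ U :=
      ((Submodule.equivMapOfInjective W.subtype W.injective_subtype U).restrictScalars
        ℝ).finrank_eq.symm
    have h₂ := Nat.find_min' hex ⟨U.map W.subtype, h₁, hU⟩
    rw [← hW] at h₂
    have h₃ : U.restrictScalars ℝ = ⊤ :=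
      Submodule.eq_top_of_finrank_eq (le_antisymm (Submodule.finrank_le _) h₂)
    simpa using h₃
  rw [← hW] at hWodd
  obtain ⟨⟨v, hv⟩, hv0⟩ := Module.finrank_pos_iff_exists_ne_zero.mp hWodd.pos
  refine ⟨v, fun h => hv0 (by simp [h]), fun a => ?_⟩
  obtain ⟨c, hc⟩ := Module.End.exists_hasEigenvalue_of_odd_finrank hWodd
    ((LinearMap.lsmul A W a).restrictScalars ℝ)
  obtain ⟨w, hw⟩ := hc.exists_hasEigenvector
  refine ⟨c, ?_⟩
  let L : W →ₗ[A] W := LinearMap.lsmul A W (a - algebraMap ℝ A c)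
  have hL (x : W) : L x = a • x - c • x := by
    simp [L]
  have hwker : w ∈ L.ker := by
    rw [LinearMap.mem_ker, hL, sub_eq_zero]
    exact hw.apply_eq_smul
  have hsum := (L.restrictScalars ℝ).finrank_range_add_finrank_ker
  have hker : L.ker = ⊤ := by
    rcases Nat.even_or_odd (Module.finrank ℝ L.ker) with hk | hk
    · have hr : Odd (Module.finrank ℝ L.range) := by
        rw [← hsum] at hWodd
        exact (Nat.odd_add.mp hWodd).mpr hk
      have hsurj : Function.Surjective L :=
        LinearMap.range_eq_top.mp (hmin _ hr)
      exact absurd (LinearMap.injective_iff_surjective (f := L.restrictScalars ℝ) |>.mpr hsurj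
        ((LinearMap.mem_ker.mp hwker).trans (map_zero L).symm)) hw.2
    · exact hmin _ hk
  have hvker : (⟨v, hv⟩ : W) ∈ L.ker := hker ▸ Submodule.mem_top
  rw [LinearMap.mem_ker, hL, sub_eq_zero] at hvker
  exact congrArg Subtype.val hvker

/-- The product replacing, in the monomial with exponent `b`, each `X i ^ d` by `g i`. -/
noncomputable def MvPolynomial.divProd {σ R : Type*} [Fintype σ] [CommRing R] (d : ℕ)
    (g : σ → MvPolynomial σ R) (b : σ →₀ ℕ) : MvPolynomial σ R :=
  ∏ i, X i ^ (b i % d) * g i ^ (b i / d)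

/-- The linear map sending the monomial with exponent `b` to `divProd d g b`. -/
noncomputable def MvPolynomial.divSubst {σ R : Type*} [Fintype σ] [CommRing R] (d : ℕ)
    (g : σ → MvPolynomial σ R) : MvPolynomial σ R →ₗ[R] MvPolynomial σ R :=
  (basisMonomials σ R).constr R (divProd d g)

namespace MvPolynomial

variable {σ R : Type*} [Fintype σ] [CommRing R] {d : ℕ} {g : σ → MvPolynomial σ R}

theorem divSubst_monomial (b : σ →₀ ℕ) (r : R) :
    divSubst d g (monomial b r) = r • divProd d g b := by
  rw [← mul_one r, ← smul_eq_mul, ← smul_monomial, map_smul, smul_eq_mul, mul_one]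
  congr 1
  exact (basisMonomials σ R).constr_basis R _ b

theorem divProd_X_pow (b : σ →₀ ℕ) :
    divProd d (fun i => (X i : MvPolynomial σ R) ^ d) b = monomial b 1 := by
  simp_rw [divProd, ← pow_mul, ← pow_add, Nat.mod_add_div]
  rw [monomial_eq, C_1, one_mul, Finsupp.prod_fintype _ _ (by simp)]

theorem map_divProd {S : Type*} [CommRing S] (φ : R →+* S) (b : σ →₀ ℕ) :
    map φ (divProd d g b) = divProd d (fun i => map φ (g i)) b := by
  simp [divProd, map_prod]

theorem totalDegree_divProd_le (hg : ∀ i, (g i).totalDegree ≤ d) (b : σ →₀ ℕ) :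
    (divProd d g b).totalDegree ≤ b.degree := by
  rw [Finsupp.degree_eq_sum]
  refine (totalDegree_finsetProd _ _).trans (Finset.sum_le_sum fun i _ => ?_)
  calc (X i ^ (b i % d) * g i ^ (b i / d)).totalDegree
      ≤ b i % d + b i / d * d := by
        refine (totalDegree_mul _ _).trans (add_le_add ?_ ?_)
        · rcases subsingleton_or_nontrivial R with _ | _
          · simp [Subsingleton.elim (X i ^ (b i % d) : MvPolynomial σ R) 0]
          · simp
        exact (totalDegree_pow _ _).trans (Nat.mul_le_mul_left _ (hg i))
    _ = b i := Nat.mod_add_div' _ _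

theorem divProd_add_single [DecidableEq σ] (hd : 0 < d) (b : σ →₀ ℕ) (i : σ) :
    divProd d g (b + Finsupp.single i d) = g i * divProd d g b := by
  rw [divProd, divProd, ← Finset.mul_prod_erase _ _ (Finset.mem_univ i),
    ← Finset.mul_prod_erase _ (fun j => X j ^ (b j % d) * g j ^ (b j / d)) (Finset.mem_univ i)]
  have : ∏ j ∈ Finset.univ.erase i, X j ^ ((b + Finsupp.single i d) j % d) *
      g j ^ ((b + Finsupp.single i d) j / d) =
      ∏ j ∈ Finset.univ.erase i, X j ^ (b j % d) * g j ^ (b j / d) := by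
    refine Finset.prod_congr rfl fun j hj => ?_
    simp [Finsupp.single_eq_of_ne (Finset.ne_of_mem_erase hj)]
  rw [this]
  simp [Nat.add_div_right _ hd, pow_succ]
  ring

theorem divSubst_mul_X_pow (hd : 0 < d) (p : MvPolynomial σ R) (i : σ) :
    divSubst d g (p * X i ^ d) = g i * divSubst d g p := by
  classical
  induction p using MvPolynomial.induction_on' with
  | monomial b r =>
    rw [X_pow_eq_monomial, monomial_mul, mul_one, divSubst_monomial, divSubst_monomial,
      divProd_add_single hd, mul_smul_comm]
  | add p q hp hq => rw [add_mul, map_add, map_add, hp, hq, mul_add]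

theorem totalDegree_divSubst_le (hg : ∀ i, (g i).totalDegree ≤ d) (p : MvPolynomial σ R) :
    (divSubst d g p).totalDegree ≤ p.totalDegree := by
  conv_lhs => rw [p.as_sum, map_sum]
  refine totalDegree_finsetSum_le fun b hb => ?_
  rw [divSubst_monomial]
  refine (totalDegree_smul_le _ _).trans ((totalDegree_divProd_le hg b).trans ?_)
  exact le_totalDegree hb

theorem divSubst_surjective_of_injective {K : Type*} [Field K] {g : σ → MvPolynomial σ K}
    (hg : ∀ i, (g i).totalDegree ≤ d) (hinj : Function.Injective (divSubst d g)) :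
    Function.Surjective (divSubst d g) := by
  intro p
  have hmaps : ∀ q ∈ restrictTotalDegree σ K p.totalDegree,
      divSubst d g q ∈ restrictTotalDegree σ K p.totalDegree := fun q hq => by
    rw [mem_restrictTotalDegree] at hq ⊢
    exact (totalDegree_divSubst_le hg q).trans hq
  have hsurj : Function.Surjective ((divSubst d g).restrict hmaps) :=
    LinearMap.injective_iff_surjective.mp fun x y hxy =>
      Subtype.ext (hinj (congrArg Subtype.val hxy))
  obtain ⟨q, hq⟩ := hsurj ⟨p, (mem_restrictTotalDegree _ _ _).mpr le_rfl⟩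
  exact ⟨q, congrArg Subtype.val hq⟩

/-- A deformation of the system `X i ^ d` keeps `divSubst` injective outside a countable set. -/
theorem countable_not_injective_divSubst (f : σ → MvPolynomial σ R) [IsDomain R] :
    {s : R | ¬ Function.Injective (divSubst d fun i => X i ^ d + C s * f i)}.Countable := by
  classical
  let G : σ → MvPolynomial σ (Polynomial R) := fun i =>
    X i ^ d + C Polynomial.X * map Polynomial.C (f i)
  have hG (s : R) (b : σ →₀ ℕ) : map (Polynomial.evalRingHom s) (divProd d G b) =
      divProd d (fun i => X i ^ d + C s * f i) b := by
    rw [map_divProd]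
    congr 1
    funext i
    have : (Polynomial.evalRingHom s).comp Polynomial.C = RingHom.id R := by ext; simp
    simp [G, map_map, this, MvPolynomial.map_id]
  let M (N : ℕ) : Matrix {b : σ →₀ ℕ // b.degree ≤ N} {b : σ →₀ ℕ // b.degree ≤ N}
      (Polynomial R) := Matrix.of fun b b' => coeff b.1 (divProd d G b'.1)
  have hfin (N : ℕ) : Finite {b : σ →₀ ℕ // b.degree ≤ N} :=
    (Finsupp.finite_of_degree_le N).to_subtype
  have (N : ℕ) : Fintype {b : σ →₀ ℕ // b.degree ≤ N} := Fintype.ofFinite _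
  have hM (N : ℕ) (s : R) : (M N).map (Polynomial.evalRingHom s) =
      Matrix.of fun b b' => coeff b.1 (divProd d (fun i => X i ^ d + C s * f i) b'.1) := by
    ext b b'
    simp only [M, Matrix.map_apply, Matrix.of_apply]
    rw [← coeff_map, hG]
  have hdet (N : ℕ) : (M N).det ≠ 0 := by
    have h0 : ((M N).map (Polynomial.evalRingHom 0)) = 1 := by
      rw [hM]
      ext b b'
      simp [divProd_X_pow, Matrix.one_apply, coeff_monomial, Subtype.ext_iff, eq_comm]
    intro h
    have := RingHom.map_det (Polynomial.evalRingHom 0) (M N)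
    rw [h, RingHom.mapMatrix_apply, h0] at this
    simp at this
  refine (Set.countable_iUnion fun N => ((M N).det.rootSet_finite R).countable).mono ?_
  intro s hs
  by_contra hroot
  refine hs ((injective_iff_map_eq_zero _).mpr fun q hq => ?_)
  have hdets : ((M q.totalDegree).map (Polynomial.evalRingHom s)).det ≠ 0 := by
    intro h
    refine hroot (Set.mem_iUnion.mpr ⟨q.totalDegree, ?_⟩)
    rw [Polynomial.mem_rootSet]
    refine ⟨hdet _, ?_⟩
    rw [← RingHom.mapMatrix_apply, ← RingHom.map_det] at h
    simpa using h
  have hv := Matrix.eq_zero_of_mulVec_eq_zero hdets (v := fun b => coeff b.1 q) (by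
    rw [hM]
    ext b
    have hsum : divSubst d (fun i => X i ^ d + C s * f i) q =
        ∑ b' : {b : σ →₀ ℕ // b.degree ≤ q.totalDegree},
          coeff b'.1 q • divProd d (fun i => X i ^ d + C s * f i) b'.1 := by
      let B := (Finsupp.finite_of_degree_le (σ := σ) q.totalDegree).toFinset
      have hB : q.support ⊆ B := fun b hb =>
        (Set.Finite.mem_toFinset _).mpr (le_totalDegree hb)
      conv_lhs => rw [q.as_sum, map_sum]
      simp_rw [divSubst_monomial]
      rw [Finset.sum_subset hB fun b _ hb => by rw [notMem_support_iff.mp hb, zero_smul]]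
      exact Finset.sum_subtype _ (by simp [B]) _
    rw [hq] at hsum
    simpa [Matrix.mulVec, dotProduct, coeff_sum, mul_comm] using
      (congrArg (coeff b.1) hsum).symm)
  ext b
  by_cases hb : b.degree ≤ q.totalDegree
  · exact congrFun hv ⟨b, hb⟩
  · rw [coeff_zero]
    by_contra h
    exact hb (le_totalDegree (mem_support_iff.mpr h))

/-- If `divSubst` is bijective, then the monomials with exponents `< d` form a basis modulo `g`. -/
theorem finrank_quotient_span_of_bijective {K : Type*} [Field K] {g : σ → MvPolynomial σ K}
    (hd : 0 < d) (hbij : Function.Bijective (divSubst d g)) :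
    Module.Finite K (MvPolynomial σ K ⧸ Ideal.span (Set.range g)) ∧
      Module.finrank K (MvPolynomial σ K ⧸ Ideal.span (Set.range g)) = d ^ Fintype.card σ := by
  classical
  let e : MvPolynomial σ K ≃ₗ[K] MvPolynomial σ K := LinearEquiv.ofBijective _ hbij
  let box (a : σ → Fin d) : σ →₀ ℕ := Finsupp.equivFunOnFinite.symm fun i => (a i : ℕ)
  let π : MvPolynomial σ K →ₗ[K] (σ → Fin d) → K := LinearMap.pi fun a => lcoeff K (box a)
  have hbox : Function.Injective box := fun a a' h => by
    funext i
    exact Fin.ext (DFunLike.congr_fun h i)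
  have hπ : Function.Surjective π := fun v => by
    refine ⟨∑ a, monomial (box a) (v a), ?_⟩
    funext a
    simp [π, coeff_monomial, hbox.eq_iff]
  let φ : MvPolynomial σ K →ₗ[K] (σ → Fin d) → K := π ∘ₗ e.symm.toLinearMap
  have hφ : Function.Surjective φ := hπ.comp e.symm.surjective
  have hker : φ.ker = (Ideal.span (Set.range g)).restrictScalars K := by
    ext p
    obtain ⟨q, rfl⟩ := e.surjective p
    rw [LinearMap.mem_ker, Submodule.restrictScalars_mem]
    simp only [φ, LinearMap.comp_apply, LinearEquiv.coe_coe, e.symm_apply_apply]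
    constructor
    · intro hq
      change divSubst d g q ∈ _
      rw [q.as_sum, map_sum]
      refine Submodule.sum_mem _ fun b hb => ?_
      rw [divSubst_monomial, smul_eq_C_mul]
      refine Ideal.mul_mem_left _ _ ?_
      obtain ⟨i, hi⟩ : ∃ i, d ≤ b i := by
        by_contra! h
        refine mem_support_iff.mp hb ?_
        have := congrFun hq fun i => ⟨b i, h i⟩
        have hb' : box (fun i => ⟨b i, h i⟩) = b := Finsupp.ext fun i => rfl
        rwa [← hb']
      rw [← tsub_add_cancel_of_le (Finsupp.single_le_iff.mpr hi), divProd_add_single hd]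
      exact Ideal.mul_mem_right _ _ (Ideal.subset_span ⟨i, rfl⟩)
    · intro hq
      obtain ⟨c, hc⟩ := (Ideal.mem_span_range_iff_exists_fun).mp hq
      have key (i : σ) : π (e.symm (c i * g i)) = 0 := by
        obtain ⟨r, hr⟩ := e.surjective (c i)
        have : c i * g i = e (r * X i ^ d) := by
          rw [← hr, mul_comm]
          exact (divSubst_mul_X_pow hd r i).symm
        rw [this, e.symm_apply_apply]
        funext a
        have hlt : ¬ Finsupp.single i d ≤ box a := by
          rw [Finsupp.single_le_iff, not_le]
          exact (a i).isLt
        simp [π, X_pow_eq_monomial, coeff_mul_monomial', hlt]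
      rw [← e.symm_apply_apply q, ← hc, map_sum, map_sum]
      exact Finset.sum_eq_zero fun i _ => key i
  let E : (MvPolynomial σ K ⧸ Ideal.span (Set.range g)) ≃ₗ[K] ((σ → Fin d) → K) :=
    (Submodule.quotEquivOfEq _ _ hker.symm).trans (φ.quotKerEquivOfSurjective hφ)
  exact ⟨Module.Finite.equiv E.symm, by rw [E.finrank_eq]; simp⟩

/-- An ideal of odd real codimension has a real zero. -/
theorem exists_zero_of_odd_finrank_quotient {σ : Type*} {I : Ideal (MvPolynomial σ ℝ)}
    [Module.Finite ℝ (MvPolynomial σ ℝ ⧸ I)]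
    (hodd : Odd (Module.finrank ℝ (MvPolynomial σ ℝ ⧸ I))) :
    ∃ x : σ → ℝ, ∀ p ∈ I, eval x p = 0 := by
  obtain ⟨v, hv, hvec⟩ :=
    exists_common_eigenvector_of_odd_finrank (A := MvPolynomial σ ℝ ⧸ I) hodd
  choose x hx using fun i => hvec (Ideal.Quotient.mk I (X i))
  have heval (p : MvPolynomial σ ℝ) : Ideal.Quotient.mk I p * v = eval x p • v := by
    induction p using MvPolynomial.induction_on with
    | C a =>
      obtain ⟨w, rfl⟩ := Ideal.Quotient.mk_surjective v
      rw [eval_C, ← map_mul, C_mul']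
      rfl
    | add p q hp hq => rw [map_add, add_mul, hp, hq, map_add, add_smul]
    | mul_X p i hp =>
      rw [map_mul, mul_assoc, ← smul_eq_mul (Ideal.Quotient.mk I (X i)), hx, mul_smul_comm, hp,
        map_mul, eval_X, smul_smul, mul_comm]
  refine ⟨x, fun p hp => ?_⟩
  have hzero := heval p
  rw [Ideal.Quotient.eq_zero_iff_mem.mpr hp, zero_mul] at hzero
  exact (smul_eq_zero.mp hzero.symm).resolve_right hv

/-- A generic real system of odd degree `d` with leading terms deforming `X i ^ d` has a zero. -/
theorem countable_not_exists_zero (hodd : Odd d) (f : σ → MvPolynomial σ ℝ)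
    (hf : ∀ i, (f i).totalDegree ≤ d) :
    {s : ℝ | ¬ ∃ x : σ → ℝ, ∀ i, x i ^ d + s * eval x (f i) = 0}.Countable := by
  refine (countable_not_injective_divSubst (d := d) f).mono ?_
  intro s hs hinj
  refine hs ?_
  let g : σ → MvPolynomial σ ℝ := fun i => X i ^ d + C s * f i
  have hg (i : σ) : (g i).totalDegree ≤ d := by
    refine (totalDegree_add _ _).trans (max_le (by simp) ((totalDegree_mul _ _).trans ?_))
    simpa using hf i
  obtain ⟨hfin, hrank⟩ := finrank_quotient_span_of_bijective (g := g) hodd.pos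
    ⟨hinj, divSubst_surjective_of_injective hg hinj⟩
  obtain ⟨x, hx⟩ := exists_zero_of_odd_finrank_quotient (hrank ▸ hodd.pow)
  exact ⟨x, fun i => by simpa [g] using hx _ (Ideal.subset_span ⟨i, rfl⟩)⟩

/-- The odd part of a polynomial. -/
noncomputable def oddPart {σ R : Type*} [CommRing R] (p : MvPolynomial σ R) : MvPolynomial σ R :=
  ∑ m ∈ p.support with Odd m.degree, monomial m (coeff m p)

theorem eval_oddPart {σ : Type*} [Finite σ] (p : MvPolynomial σ ℝ) (x : σ → ℝ) :
    eval x p.oddPart = (eval x p - eval (-x) p) / 2 := by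
  have := Fintype.ofFinite σ
  rw [oddPart, Finset.sum_filter, map_sum]
  conv_rhs => rw [p.as_sum, map_sum, map_sum]
  rw [← Finset.sum_sub_distrib, Finset.sum_div]
  refine Finset.sum_congr rfl fun m _ => ?_
  have hneg : eval (-x) (monomial m (coeff m p)) =
      (-1) ^ m.degree * eval x (monomial m (coeff m p)) := by
    simp only [eval_monomial, Finsupp.prod_fintype _ _ (fun _ => pow_zero _), Pi.neg_apply,
      Finsupp.degree_eq_sum]
    simp_rw [neg_pow (x _), Finset.prod_mul_distrib, Finset.prod_pow_eq_pow_sum]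
    ring
  rw [hneg]
  split_ifs with h
  · rw [h.neg_one_pow]; ring
  · rw [(Nat.not_odd_iff_even.mp h).neg_one_pow]; simp

theorem degree_le_totalDegree {σ R : Type*} [CommSemiring R] {p : MvPolynomial σ R} {m : σ →₀ ℕ}
    (hm : m ∈ p.support) : m.degree ≤ p.totalDegree :=
  le_totalDegree hm

variable {n : ℕ}

/-- The dehomogenization at `x₀ = 1` of the degree `d` form agreeing on the unit sphere with the
odd part of `p`. -/
noncomputable def sphereDehomogenization (d : ℕ) (p : MvPolynomial (Fin (n + 1)) ℝ) :
    MvPolynomial (Fin n) ℝ :=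
  ∑ m ∈ p.support with Odd m.degree,
    C (coeff m p) * (∏ i : Fin n, X i ^ m i.succ) *
      (1 + ∑ i : Fin n, X i ^ 2) ^ ((d - m.degree) / 2)

theorem totalDegree_sphereDehomogenization_le {d : ℕ} {p : MvPolynomial (Fin (n + 1)) ℝ}
    (hp : p.totalDegree ≤ d) : (sphereDehomogenization d p).totalDegree ≤ d := by
  refine totalDegree_finsetSum_le fun m hm => ?_
  have hmd := (degree_le_totalDegree (Finset.mem_filter.mp hm).1).trans hp
  have h₁ : (∏ i : Fin n, (X i : MvPolynomial (Fin n) ℝ) ^ m i.succ).totalDegree ≤ m.degree := by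
    refine (totalDegree_finsetProd _ _).trans ?_
    simp [Finsupp.degree_eq_sum, Fin.sum_univ_succ]
  have h₂ : (1 + ∑ i : Fin n, (X i : MvPolynomial (Fin n) ℝ) ^ 2).totalDegree ≤ 2 :=
    (totalDegree_add _ _).trans
      (max_le (by simp) (totalDegree_finsetSum_le fun i _ => by simp))
  refine (totalDegree_mul _ _).trans ?_
  calc _ ≤ (0 + m.degree) + (d - m.degree) / 2 * 2 := by
        refine add_le_add ((totalDegree_mul _ _).trans (add_le_add (by simp) h₁)) ?_
        exact (totalDegree_pow _ _).trans (Nat.mul_le_mul_left _ h₂)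
    _ ≤ d := by omega

theorem eval_sphereDehomogenization {d : ℕ} {p : MvPolynomial (Fin (n + 1)) ℝ} (hd : Odd d)
    (hp : p.totalDegree ≤ d) (x : Fin n → ℝ) {r : ℝ} (hr : r ≠ 0)
    (hr2 : r ^ 2 = 1 + ∑ i, x i ^ 2) :
    eval x (sphereDehomogenization d p) =
      r ^ d * eval (fun i => Fin.cons (α := fun _ => ℝ) 1 x i / r) p.oddPart := by
  rw [sphereDehomogenization, oddPart, map_sum, map_sum, Finset.mul_sum]
  refine Finset.sum_congr rfl fun m hm => ?_
  obtain ⟨hm, hodd⟩ := Finset.mem_filter.mp hm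
  have hmd := (degree_le_totalDegree hm).trans hp
  have hr' : (1 + ∑ i, x i ^ 2) ^ ((d - m.degree) / 2) = r ^ (d - m.degree) := by
    rw [← hr2, ← pow_mul, Nat.mul_div_cancel' (Nat.Odd.sub_odd hd hodd).two_dvd]
  rw [eval_monomial, Finsupp.prod_fintype _ _ (fun _ => pow_zero _)]
  simp only [div_pow, Finset.prod_div_distrib, Finset.prod_pow_eq_pow_sum,
    ← Finsupp.degree_eq_sum]
  rw [Fin.prod_univ_succ]
  simp only [map_mul, eval_C, map_prod, map_pow, eval_X, map_add, map_one, map_sum, hr',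
    Fin.cons_zero, Fin.cons_succ, one_pow, one_mul]
  rw [← Nat.sub_add_cancel hmd, pow_add, Nat.sub_add_cancel hmd]
  field_simp

/-- Approximate Borsuk–Ulam for polynomial maps. -/
theorem exists_abs_eval_oddPart_le (p : Fin n → MvPolynomial (Fin (n + 1)) ℝ) {ε : ℝ}
    (hε : 0 < ε) :
    ∃ y : Fin (n + 1) → ℝ, ∑ i, y i ^ 2 = 1 ∧ ∀ i, |eval y (p i).oddPart| ≤ ε := by
  let d := 2 * (∑ i, (p i).totalDegree) + 1
  have hd : Odd d := odd_two_mul_add_one _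
  have hp (i : Fin n) : (p i).totalDegree ≤ d := by
    have := Finset.single_le_sum (f := fun i => (p i).totalDegree) (fun _ _ => Nat.zero_le _)
      (Finset.mem_univ i)
    simp only [d]
    omega
  obtain ⟨s, hs, hs'⟩ : ∃ s, ε⁻¹ < s ∧ ∃ x : Fin n → ℝ, ∀ i,
      x i ^ d + s * eval x (sphereDehomogenization d (p i)) = 0 := by
    by_contra! h
    have huncount : ¬ (Set.Ioi ε⁻¹).Countable := by
      rw [← Cardinal.le_aleph0_iff_set_countable, Cardinal.mk_Ioi_real, not_le]
      exact Cardinal.aleph0_lt_continuum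
    refine huncount ((countable_not_exists_zero hd _ fun i =>
      totalDegree_sphereDehomogenization_le (hp i)).mono fun s hs => ?_)
    simpa using h s hs
  obtain ⟨x, hx⟩ := hs'
  have hpos : 0 < 1 + ∑ i, x i ^ 2 := by positivity
  set r := √(1 + ∑ i, x i ^ 2)
  have hr : 0 < r := Real.sqrt_pos.mpr hpos
  have hr2 : r ^ 2 = 1 + ∑ i, x i ^ 2 := Real.sq_sqrt hpos.le
  refine ⟨fun i => Fin.cons (α := fun _ => ℝ) 1 x i / r, ?_, fun i => ?_⟩
  · simp only [div_pow, ← Finset.sum_div]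
    rw [Fin.sum_univ_succ]
    simp only [Fin.cons_zero, Fin.cons_succ, one_pow]
    rw [← hr2, div_self (by positivity)]
  · have hxi := hx i
    rw [eval_sphereDehomogenization hd (hp i) x hr.ne' hr2] at hxi
    set v := eval (fun i => Fin.cons (α := fun _ => ℝ) 1 x i / r) (p i).oddPart
    have hs0 : 0 < s := (inv_pos.mpr hε).trans hs
    have hle : |x i| ≤ r := by
      refine Real.abs_le_sqrt ?_
      have := Finset.single_le_sum (f := fun i => x i ^ 2) (fun _ _ => sq_nonneg _)
        (Finset.mem_univ i)
      linarith
    have h₁ : s * |v| * r ^ d ≤ r ^ d := by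
      calc s * |v| * r ^ d = |s * (r ^ d * v)| := by
            rw [abs_mul, abs_mul, abs_of_pos hs0, abs_of_pos (pow_pos hr d)]; ring
        _ = |x i| ^ d := by rw [← abs_pow, ← abs_neg (x i ^ d)]; congr 1; linarith
        _ ≤ r ^ d := pow_le_pow_left₀ (abs_nonneg _) hle d
    have h₂ : s * |v| ≤ 1 := by
      by_contra! h
      nlinarith [pow_pos hr d]
    have h₃ : 1 < ε * s := by
      rwa [inv_lt_iff_one_lt_mul₀' hε] at hs
    by_contra! h
    nlinarith

end MvPolynomial

open MvPolynomial in
/-- Polynomials are dense in the continuous functions on a compact subset of Euclidean space. -/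
theorem exists_mvPolynomial_near_of_isCompact {ι : Type*} {K : Set (EuclideanSpace ℝ ι)}
    [CompactSpace K] {h : K → ℝ} (hh : Continuous h) {ε : ℝ} (hε : 0 < ε) :
    ∃ p : MvPolynomial ι ℝ, ∀ x : K, |eval (fun i => x.1 i) p - h x| < ε := by
  let coord (i : ι) : C(K, ℝ) := ⟨fun x => x.1 i, by fun_prop⟩
  have hsep : (aeval (R := ℝ) coord).range.SeparatesPoints := fun x y hxy => by
    obtain ⟨i, hi⟩ : ∃ i, x.1 i ≠ y.1 i := by
      by_contra! H
      exact hxy (Subtype.ext (PiLp.ext H))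
    exact ⟨coord i, ⟨coord i, ⟨X i, aeval_X _ _⟩, rfl⟩, hi⟩
  obtain ⟨⟨_, p, rfl⟩, hp⟩ :=
    ContinuousMap.exists_mem_subalgebra_near_continuous_of_separatesPoints _ hsep h hh ε hε
  refine ⟨p, fun x => ?_⟩
  have heval (q : MvPolynomial ι ℝ) : (aeval (R := ℝ) coord q) x = eval (fun i => x.1 i) q := by
    induction q using MvPolynomial.induction_on with
    | C a => simp
    | add p q hp hq => rw [map_add, map_add, ← hp, ← hq, ContinuousMap.add_apply]
    | mul_X p i hp => rw [map_mul, map_mul, ← hp, ContinuousMap.mul_apply, aeval_X, eval_X]; rfl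
  have := hp x
  rw [Real.norm_eq_abs] at this
  rw [← heval]
  exact this

open MvPolynomial in
/-- **Borsuk–Ulam theorem** for odd maps. -/
theorem exists_eq_zero_of_continuous_of_odd {n : ℕ}
    {h : Metric.sphere (0 : EuclideanSpace ℝ (Fin (n + 1))) 1 → Fin n → ℝ} (hh : Continuous h)
    (hodd : ∀ x, h (-x) = -h x) : ∃ x, h x = 0 := by
  have : Nonempty (Metric.sphere (0 : EuclideanSpace ℝ (Fin (n + 1))) 1) :=
    (NormedSpace.sphere_nonempty.mpr zero_le_one).to_subtype
  obtain ⟨x₀, -, hx₀⟩ := isCompact_univ.exists_isMinOn Set.univ_nonempty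
    (continuous_norm.comp hh).continuousOn
  by_contra! hne
  have hδ : 0 < ‖h x₀‖ := norm_pos_iff.mpr (hne x₀)
  set δ := ‖h x₀‖
  choose p hp using fun i => exists_mvPolynomial_near_of_isCompact
    ((continuous_apply i).comp hh) (show 0 < δ / 3 by positivity)
  obtain ⟨y, hy, hyp⟩ := exists_abs_eval_oddPart_le p (show 0 < δ / 3 by positivity)
  let x : Metric.sphere (0 : EuclideanSpace ℝ (Fin (n + 1))) 1 :=
    ⟨WithLp.toLp 2 y, by simp [EuclideanSpace.norm_eq, hy]⟩
  have hsmall : ‖h x‖ ≤ δ * (2 / 3) := by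
    refine (pi_norm_le_iff_of_nonneg (by positivity)).mpr fun i => ?_
    have h₁ : |eval y (p i) - h x i| < δ / 3 := hp i x
    have h₂ : |eval (-y) (p i) - h (-x) i| < δ / 3 := hp i (-x)
    have h₃ := hyp i
    rw [hodd, Pi.neg_apply] at h₂
    rw [eval_oddPart] at h₃
    rw [Real.norm_eq_abs]
    rw [abs_lt] at h₁ h₂
    rw [abs_le] at h₃ ⊢
    constructor <;> linarith
  have : δ ≤ ‖h x‖ := hx₀ (Set.mem_univ x)
  linarith

/-- A continuous self-map of the n-sphere which never identifies a point with the image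
of its antipode is surjective (a consequence of Borsuk–Ulam). -/
theorem sphere_selfmap_no_antipodal_identification_surjective
    (n : ℕ)
    (f : Metric.sphere (0 : EuclideanSpace ℝ (Fin (n + 1))) 1 →
         Metric.sphere (0 : EuclideanSpace ℝ (Fin (n + 1))) 1)
    (hf : Continuous f)
    (h : ∀ x, f (-x) ≠ f x) :
    Function.Surjective f := by
  intro v
  by_contra! hv
  have := Fact.mk (@finrank_euclideanSpace_fin ℝ _ (n + 1))
  obtain ⟨g, hg, hinj⟩ : ∃ g : Metric.sphere (0 : EuclideanSpace ℝ (Fin (n + 1))) 1 →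
      EuclideanSpace ℝ (Fin n), Continuous g ∧ ∀ x y, g x = g y → f x = f y := by
    have hmem (x) : f x ∈ (stereographic' n v).source := by simpa using hv x
    exact ⟨fun x => stereographic' n v (f x),
      (stereographic' n v).continuousOn.comp_continuous hf hmem,
      fun x y => (stereographic' n v).injOn (hmem x) (hmem y)⟩
  obtain ⟨x, hx⟩ := exists_eq_zero_of_continuous_of_odd
    (h := fun x => (g x).ofLp - (g (-x)).ofLp) (by fun_prop) (fun x => by simp)
  exact h x (hinj x (-x) (WithLp.ofLp_injective 2 (sub_eq_zero.mp hx))).symm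
end

section
/- For every K ≥ 1 and every positive integer n there exists D ≥ 0 with the following property. For every map f : ℝⁿ → ℝⁿ such that dist(f(x), f(y)) ≤ K·dist(x,y) + K for all x, y ∈ ℝⁿ (i.e., f is (K,K)-coarsely Lipschitz), there exists a continuous map g : ℝⁿ → ℝⁿ with dist(f(x), g(x)) ≤ D for all x ∈ ℝⁿ. -/
/-- A (K,K)-coarsely Lipschitz self-map of ℝⁿ can be approximated, up to a uniformly
bounded error depending only on K and n, by a continuous map. -/
theorem coarseLipschitz_approx_continuous
    (K : ℝ) (hK : 1 ≤ K) (n : ℕ) (hn : 0 < n) :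
    ∃ D : ℝ, 0 ≤ D ∧
      ∀ f : EuclideanSpace ℝ (Fin n) → EuclideanSpace ℝ (Fin n),
        (∀ x y, dist (f x) (f y) ≤ K * dist x y + K) →
        ∃ g : EuclideanSpace ℝ (Fin n) → EuclideanSpace ℝ (Fin n),
          Continuous g ∧ ∀ x, dist (f x) (g x) ≤ D := by
  refine ⟨2 * K, by linarith, fun f hf => ?_⟩
  obtain ⟨g, hg⟩ := exists_continuous_forall_mem_convex_of_local_const
    (t := fun x => Metric.closedBall (f x) (2 * K)) (fun x => convex_closedBall _ _) (fun x => by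
      refine ⟨f x, ?_⟩
      filter_upwards [Metric.ball_mem_nhds x one_pos] with y hy
      have hxy : dist x y ≤ 1 := (Metric.mem_ball'.mp hy).le
      rw [Metric.mem_closedBall]
      nlinarith [hf x y])
  exact ⟨g, g.continuous, fun x => Metric.mem_closedBall'.mp (hg x)⟩
end

section
/- Let n ≥ 1 and let Y₁, …, Y_k be finitely many closed subsets of ℝⁿ such that each Yᵢ is homeomorphic to the orthant [0,∞)^{tᵢ} for some natural number tᵢ with tᵢ ≤ n − 2. Then the complement ℝⁿ ∖ (Y₁ ∪ ⋯ ∪ Y_k) is path-connected. -/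
/-- The orthant `[0,∞)^t`, as a subset of `ℝ^t`. -/
def orthant (t : ℕ) : Set (Fin t → ℝ) := {x | ∀ i, 0 ≤ x i}

open Set Metric MeasureTheory Topology
open scoped NNReal

theorem exists_polynomial_eval_eq_det_one_add_smul {n : ℕ}
    (A : (Fin n → ℝ) →L[ℝ] (Fin n → ℝ)) :
    ∃ p : Polynomial ℝ, p.natDegree ≤ n ∧ ∀ s : ℝ, p.eval s = (1 + s • A).det := by
  set M := LinearMap.toMatrix' (A : (Fin n → ℝ) →ₗ[ℝ] (Fin n → ℝ)) with hM
  refine ⟨_, (Polynomial.natDegree_det_X_add_C_le M 1).trans_eq (Fintype.card_fin n), fun s => ?_⟩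
  rw [← Polynomial.coe_evalRingHom, RingHom.map_det, ContinuousLinearMap.det,
    ← LinearMap.det_toMatrix']
  congr 1
  ext i j
  by_cases hij : i = j <;> simp [hM, hij, LinearMap.toMatrix'_apply] <;> ring

theorem det_one_add_smul_pos {n : ℕ} {A : (Fin n → ℝ) →L[ℝ] (Fin n → ℝ)} {t : ℝ} (ht : 0 ≤ t)
    (htA : t * ‖A‖ < 1) : 0 < (1 + t • A).det := by
  obtain ⟨p, -, hp⟩ := exists_polynomial_eval_eq_det_one_add_smul A
  have hne : ∀ s ∈ Icc 0 t, p.eval s ≠ 0 := by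
    intro s hs
    rw [hp]
    have hu : IsUnit (1 + s • A) := by
      have : ‖-(s • A)‖ < 1 := by
        rw [norm_neg, norm_smul, Real.norm_of_nonneg hs.1]
        exact (mul_le_mul_of_nonneg_right hs.2 (norm_nonneg _)).trans_lt htA
      simpa using isUnit_one_sub_of_norm_lt_one this
    exact ((hu.map ContinuousLinearMap.toLinearMapRingHom).map LinearMap.det).ne_zero
  rw [← hp]
  by_contra hneg
  have h0 : p.eval 0 = 1 := by simp [hp, ContinuousLinearMap.det]
  obtain ⟨s, hs, hs0⟩ := intermediate_value_Icc' ht p.continuous.continuousOn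
    (show (0 : ℝ) ∈ Icc (p.eval t) (p.eval 0) from ⟨not_lt.1 hneg, by simp [h0]⟩)
  exact hne s hs hs0

theorem lipschitzWith_coe_smul {E : Type*} [NormedAddCommGroup E] [NormedSpace ℝ E]
    {h : E → E} {K : ℝ≥0} (hK : LipschitzWith K h) (t : ℝ≥0) :
    LipschitzWith (t * K) fun x => (t : ℝ) • h x := by
  simpa [Function.comp_def] using (lipschitzWith_smul (t : ℝ)).comp hK

theorem bijective_add_smul_of_lipschitzWith {E : Type*} [NormedAddCommGroup E] [NormedSpace ℝ E]
    [CompleteSpace E] {h : E → E} {K : ℝ≥0} (hK : LipschitzWith K h) {t : ℝ≥0} (htK : t * K < 1) :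
    Function.Bijective fun x => x + (t : ℝ) • h x := by
  have hL := lipschitzWith_coe_smul hK t
  constructor
  · intro x y hxy
    have h1 : x - y = (t : ℝ) • h y - (t : ℝ) • h x := by
      have := hxy
      simp only at this
      rw [sub_eq_sub_iff_add_eq_add, this, add_comm]
    have h2 := hL.dist_le_mul y x
    rw [dist_eq_norm, ← h1, ← dist_eq_norm, dist_comm y x] at h2
    by_contra hne
    have h3 : 0 < dist x y := dist_pos.2 hne
    have h4 : ((t * K : ℝ≥0) : ℝ) < 1 := by exact_mod_cast htK
    nlinarith
  · intro y
    have hc : ContractingWith (t * K) fun x => y - (t : ℝ) • h x := by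
      refine ⟨htK, LipschitzWith.of_dist_le_mul fun a b => ?_⟩
      simpa only [dist_sub_left] using hL.dist_le_mul a b
    have := hc.fixedPoint_isFixedPt
    exact ⟨hc.fixedPoint, by
      have h5 : y - (t : ℝ) • h hc.fixedPoint = hc.fixedPoint := this
      simpa using (sub_eq_iff_eq_add.1 h5).symm⟩

theorem image_closedBall_add_smul {E : Type*} [NormedAddCommGroup E] [NormedSpace ℝ E]
    [CompleteSpace E] {h : E → E} {K : ℝ≥0} (hK : LipschitzWith K h) {R : ℝ}
    (hR : ∀ x, R < ‖x‖ → h x = 0) {t : ℝ≥0} (htK : t * K < 1) :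
    (fun x => x + (t : ℝ) • h x) '' closedBall 0 R = closedBall 0 R := by
  have hb := bijective_add_smul_of_lipschitzWith hK htK
  have hc : (fun x => x + (t : ℝ) • h x) '' (closedBall 0 R)ᶜ = (closedBall 0 R)ᶜ := by
    have : EqOn (fun x => x + (t : ℝ) • h x) id (closedBall 0 R)ᶜ := fun x hx => by
      simp [hR x (by simpa using hx)]
    rw [this.image_eq, image_id]
  rw [image_compl_eq hb, compl_inj_iff] at hc
  exact hc

theorem volume_image_eq_zero_of_lipschitzWith {n : ℕ} {g : (Fin n → ℝ) → (Fin n → ℝ)} {K : ℝ≥0}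
    (hg : LipschitzWith K g) {s : Set (Fin n → ℝ)} (hs : volume s = 0) : volume (g '' s) = 0 := by
  rw [← hausdorffMeasure_pi_real] at hs ⊢
  have := hg.hausdorffMeasure_image_le (d := (Fintype.card (Fin n) : ℝ)) (by positivity) s
  rw [hs, mul_zero] at this
  exact le_antisymm this zero_le

theorem lintegral_det_one_add_smul_fderiv {n : ℕ} {h : (Fin n → ℝ) → (Fin n → ℝ)} {K : ℝ≥0}
    (hK : LipschitzWith K h) {R : ℝ} (hR : ∀ x, R < ‖x‖ → h x = 0) {t : ℝ≥0} (htK : t * K < 1) :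
    ∫⁻ x in closedBall 0 R, ENNReal.ofReal (1 + (t : ℝ) • fderiv ℝ h x).det =
      volume (closedBall (0 : Fin n → ℝ) R) := by
  set g : (Fin n → ℝ) → (Fin n → ℝ) := fun x => x + (t : ℝ) • h x with hg
  set D := {x | DifferentiableAt ℝ h x} with hD
  have hDm : MeasurableSet D := measurableSet_of_differentiableAt ℝ h
  have hDn : volume Dᶜ = 0 := hK.ae_differentiableAt
  set B : Set (Fin n → ℝ) := closedBall 0 R
  have hgL : LipschitzWith (1 + t * K) g :=
    LipschitzWith.id.add (lipschitzWith_coe_smul hK t)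
  have himg : volume (g '' (B ∩ D)) = volume B := by
    have h1 : g '' B = B := image_closedBall_add_smul hK hR htK
    have h2 : volume (g '' (B ∩ Dᶜ)) = 0 := volume_image_eq_zero_of_lipschitzWith hgL
      (measure_mono_null inter_subset_right hDn)
    refine le_antisymm ((measure_mono (image_mono inter_subset_left)).trans_eq (by rw [h1])) ?_
    calc volume B = volume (g '' (B ∩ D) ∪ g '' (B ∩ Dᶜ)) := by
          rw [← image_union, inter_union_compl, h1]
      _ ≤ volume (g '' (B ∩ D)) + volume (g '' (B ∩ Dᶜ)) := measure_union_le _ _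
      _ = _ := by rw [h2, add_zero]
  have hder : ∀ x ∈ B ∩ D, HasFDerivWithinAt g (1 + (t : ℝ) • fderiv ℝ h x) (B ∩ D) x := by
    intro x hx
    have hx2 : DifferentiableAt ℝ h x := hx.2
    exact ((hasFDerivAt_id x).add (hx2.hasFDerivAt.const_smul (t : ℝ))).hasFDerivWithinAt
  rw [← himg, ← lintegral_abs_det_fderiv_eq_addHaar_image volume
    (isClosed_closedBall.measurableSet.inter hDm) hder
    (bijective_add_smul_of_lipschitzWith hK htK).1.injOn]
  have hpos : ∀ x, |(1 + (t : ℝ) • fderiv ℝ h x).det| = (1 + (t : ℝ) • fderiv ℝ h x).det :=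
    fun x => by
      refine abs_of_pos (det_one_add_smul_pos t.2 ?_)
      calc (t : ℝ) * ‖fderiv ℝ h x‖ ≤ t * K :=
            mul_le_mul_of_nonneg_left (norm_fderiv_le_of_lipschitz ℝ hK) t.2
        _ < 1 := by exact_mod_cast htK
  simp only [hpos]
  exact setLIntegral_congr (ae_eq_set.2 ⟨by rw [sdiff_self_inter]
                                            exact measure_mono_null (fun x hx => hx.2) hDn,
    by rw [inter_sdiff_assoc, inter_comm]; simp [sdiff_eq, inter_assoc, B]⟩)

/-- A Lipschitz perturbation of the identity supported in a ball has integrated Jacobian equal to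
the volume of the ball. For small multiples `s • h` this is the change of variables formula, and
both sides are polynomial in `s`. -/
theorem integral_det_one_add_fderiv {n : ℕ} {h : (Fin n → ℝ) → (Fin n → ℝ)} {K : ℝ≥0}
    (hK : LipschitzWith K h) {R : ℝ} (hR : ∀ x, R < ‖x‖ → h x = 0) :
    ∫ x in closedBall 0 R, (1 + fderiv ℝ h x).det =
      volume.real (closedBall (0 : Fin n → ℝ) R) := by
  set v : ℕ → ℝ≥0 := fun j => ((j + 1) * (K + 1))⁻¹ with hv
  have hvpos : ∀ j, v j * K < 1 := fun j => by
    rw [hv]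
    simp only
    rw [mul_comm, ← div_eq_mul_inv, div_lt_one (by positivity)]
    calc K < K + 1 := lt_add_one K
      _ ≤ (j + 1) * (K + 1) := le_mul_of_one_le_left (by positivity) (by simp)
  have hvinj : Function.Injective fun j => (v j : ℝ) := by
    intro i j hij
    have h1 : v i = v j := NNReal.coe_injective hij
    have h2 := mul_right_cancel₀ (by positivity : K + 1 ≠ 0) (inv_injective h1)
    exact_mod_cast add_right_cancel h2
  have hmeas : ∀ s : ℝ, Measurable fun x => (1 + s • fderiv ℝ h x).det := fun s =>
    ContinuousLinearMap.continuous_det.measurable.comp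
      (measurable_const.add ((measurable_fderiv ℝ h).const_smul s))
  have hnn : ∀ j x, 0 ≤ (1 + (v j : ℝ) • fderiv ℝ h x).det := fun j x => by
    refine (det_one_add_smul_pos (v j).2 ?_).le
    calc (v j : ℝ) * ‖fderiv ℝ h x‖ ≤ v j * K :=
          mul_le_mul_of_nonneg_left (norm_fderiv_le_of_lipschitz ℝ hK) (v j).2
      _ < 1 := by exact_mod_cast hvpos j
  have hfin : volume (closedBall (0 : Fin n → ℝ) R) ≠ ⊤ := measure_closedBall_lt_top.ne
  have hint : ∀ j, IntegrableOn (fun x => (1 + (v j : ℝ) • fderiv ℝ h x).det)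
      (closedBall 0 R) := fun j => by
    refine ⟨(hmeas _).aestronglyMeasurable, ?_⟩
    rw [hasFiniteIntegral_iff_ofReal (Filter.Eventually.of_forall (hnn j)),
      lintegral_det_one_add_smul_fderiv hK hR (hvpos j)]
    exact hfin.lt_top
  have hval : ∀ j, ∫ x in closedBall 0 R, (1 + (v j : ℝ) • fderiv ℝ h x).det =
      volume.real (closedBall (0 : Fin n → ℝ) R) := fun j => by
    rw [integral_eq_lintegral_of_nonneg_ae (Filter.Eventually.of_forall (hnn j))
      (hmeas _).aestronglyMeasurable, lintegral_det_one_add_smul_fderiv hK hR (hvpos j)]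
    rfl
  set s := Finset.range (n + 1)
  set w : ℕ → ℝ := fun j => (Lagrange.basis s (fun j => (v j : ℝ)) j).eval 1
  have hsum : ∑ j ∈ s, w j = 1 := by
    rw [← Polynomial.eval_finsetSum, Lagrange.sum_basis hvinj.injOn ⟨0, by simp [s]⟩,
      Polynomial.eval_one]
  have hdet : ∀ x, (1 + fderiv ℝ h x).det =
      ∑ j ∈ s, (1 + (v j : ℝ) • fderiv ℝ h x).det * w j := fun x => by
    obtain ⟨p, hpd, hp⟩ := exists_polynomial_eval_eq_det_one_add_smul (fderiv ℝ h x)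
    have h1 := Lagrange.eq_interpolate (s := s) (v := fun j => (v j : ℝ)) (f := p) hvinj.injOn
      (Polynomial.degree_le_natDegree.trans_lt (by
        simp only [s, Finset.card_range]; exact_mod_cast Nat.lt_succ_of_le hpd))
    have h2 := congrArg (Polynomial.eval 1) h1
    rw [hp, one_smul, Lagrange.interpolate_apply, Polynomial.eval_finsetSum] at h2
    rw [h2]
    exact Finset.sum_congr rfl fun j _ => by simp [hp, w]
  simp only [hdet]
  rw [integral_finsetSum _ fun j _ => (hint j).mul_const _]
  simp only [integral_mul_const, hval]
  rw [← Finset.mul_sum, hsum, mul_one]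

/-- Coordinatewise truncation to `[-R, R]`, the nearest-point map to a closed ball for the
sup norm. -/
def truncate {n : ℕ} (R : ℝ) (x : Fin n → ℝ) : Fin n → ℝ := fun i => max (-R) (min R (x i))

theorem lipschitzWith_truncate {n : ℕ} (R : ℝ) :
    LipschitzWith 1 (truncate R : (Fin n → ℝ) → (Fin n → ℝ)) :=
  LipschitzWith.mk_one fun x y => (dist_pi_le_iff dist_nonneg).2 fun i => by
    simpa [truncate] using
      (((LipschitzWith.eval i).const_min R).const_max (-R)).dist_le_mul x y

theorem truncate_mem_closedBall {n : ℕ} {R : ℝ} (hR : 0 ≤ R) (x : Fin n → ℝ) :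
    truncate R x ∈ closedBall (0 : Fin n → ℝ) R := by
  rw [mem_closedBall_zero_iff, pi_norm_le_iff_of_nonneg hR]
  intro i
  rw [Real.norm_eq_abs, abs_le]
  exact ⟨le_max_left _ _, max_le (by linarith) (min_le_left _ _)⟩

theorem truncate_of_norm_le {n : ℕ} {R : ℝ} {x : Fin n → ℝ} (hx : ‖x‖ ≤ R) :
    truncate R x = x := by
  ext i
  have h := abs_le.1 ((norm_le_pi_norm x i).trans hx)
  simp [truncate, h.1, h.2]

theorem norm_truncate_of_le_norm {n : ℕ} {R : ℝ} (hR : 0 ≤ R) {x : Fin n → ℝ} (hx : R < ‖x‖) :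
    ‖truncate R x‖ = R := by
  refine le_antisymm (mem_closedBall_zero_iff.1 (truncate_mem_closedBall hR x)) ?_
  by_contra hlt
  push Not at hlt
  refine hx.not_ge ((pi_norm_le_iff_of_nonneg hR).2 fun i => ?_)
  have h := abs_lt.1 ((norm_le_pi_norm (truncate R x) i).trans_lt hlt)
  simp only [truncate, max_lt_iff, lt_max_iff, min_lt_iff, lt_min_iff] at h
  rw [Real.norm_eq_abs, abs_le]
  grind

theorem det_fderiv_eq_zero_of_norm_eventuallyEq {n : ℕ} [NeZero n]
    {r : (Fin n → ℝ) → (Fin n → ℝ)} {R : ℝ} {x : Fin n → ℝ} (h : ∀ᶠ y in 𝓝 x, ‖r y‖ = R) :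
    (fderiv ℝ r x).det = 0 := by
  by_cases hd : DifferentiableAt ℝ r x
  swap
  · rw [fderiv_zero_of_not_differentiableAt hd]
    simp [ContinuousLinearMap.det]
  obtain ⟨i, hi⟩ : ∃ i, ‖r x i‖ = R := by
    obtain ⟨i, -, hi⟩ := Finset.exists_mem_eq_sup' (Finset.univ_nonempty (α := Fin n))
      fun i => ‖r x i‖
    refine ⟨i, ?_⟩
    rw [← h.self_of_nhds]
    refine le_antisymm (norm_le_pi_norm _ _) ((pi_norm_le_iff_of_nonneg (norm_nonneg _)).2 ?_)
    intro j
    rw [← hi]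
    exact Finset.le_sup' (fun i => ‖r x i‖) (Finset.mem_univ j)
  have hle : ∀ᶠ y in 𝓝 x, |r y i| ≤ R := h.mono fun y hy => by
    rw [← hy]
    exact norm_le_pi_norm (r y) i
  have hext : IsLocalExtr (fun y => r y i) x := by
    rw [Real.norm_eq_abs] at hi
    rcases abs_choice (r x i) with habs | habs
    · exact Or.inr (hle.mono fun y hy => by
        simp only
        linarith [le_abs_self (r y i)])
    · exact Or.inl (hle.mono fun y hy => by
        simp only
        linarith [neg_abs_le (r y i)])
  have hzero : ∀ v, fderiv ℝ r x v i = 0 := fun v => by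
    have h1 := hext.fderiv_eq_zero
    have h2 := (hasFDerivAt_pi'.1 hd.hasFDerivAt i).fderiv
    rw [h1] at h2
    exact (DFunLike.congr_fun h2 v).symm
  rw [ContinuousLinearMap.det, ← LinearMap.det_toMatrix']
  exact Matrix.det_eq_zero_of_row_eq_zero i fun j => by simp [LinearMap.toMatrix'_apply, hzero]

/-- There is no locally Lipschitz retraction of a closed ball onto its bounding sphere. -/
theorem not_locallyLipschitz_retraction_closedBall {n : ℕ} {r : (Fin n → ℝ) → (Fin n → ℝ)}
    (hr : LocallyLipschitz r) {R : ℝ} (hR : 0 < R) (hnorm : ∀ x, ‖x‖ ≤ R → ‖r x‖ = R)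
    (hid : ∀ x, ‖x‖ = R → r x = x) : False := by
  rcases Nat.eq_zero_or_pos n with rfl | hn
  · have h0 := hnorm 0 (by rw [norm_zero]; exact hR.le)
    rw [Subsingleton.elim (r 0) 0, norm_zero] at h0
    exact hR.ne h0
  have : NeZero n := ⟨hn.ne'⟩
  obtain ⟨K, hK⟩ := (hr.locallyLipschitzOn (s := closedBall 0 R)).exists_lipschitzOnWith_of_compact
    (isCompact_closedBall _ _)
  set h : (Fin n → ℝ) → (Fin n → ℝ) := fun x => r (truncate R x) - truncate R x with hh
  have hL : LipschitzWith (K + 1) h := by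
    have h1 : LipschitzWith (K * 1) (r ∘ truncate R) := lipschitzOnWith_univ.1
      (hK.comp (lipschitzWith_truncate R).lipschitzOnWith
        fun x _ => truncate_mem_closedBall hR.le x)
    rw [mul_one] at h1
    exact h1.sub (lipschitzWith_truncate R)
  have h0 : ∀ x, R < ‖x‖ → h x = 0 := fun x hx => by
    simp [hh, hid _ (norm_truncate_of_le_norm hR.le hx)]
  have hint := integral_det_one_add_fderiv hL h0
  have hdet : ∀ᵐ x ∂volume.restrict (closedBall (0 : Fin n → ℝ) R),
      (1 + fderiv ℝ h x).det = 0 := by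
    have hsphere : ∀ᵐ x : Fin n → ℝ, x ∉ sphere (0 : Fin n → ℝ) R :=
      measure_eq_zero_iff_ae_notMem.1 (Measure.addHaar_sphere_of_ne_zero _ _ hR.ne')
    filter_upwards [ae_restrict_of_ae hL.ae_differentiableAt, ae_restrict_of_ae hsphere,
      ae_restrict_mem isClosed_closedBall.measurableSet] with x hd hs hx
    have hnhds : ball (0 : Fin n → ℝ) R ∈ 𝓝 x := isOpen_ball.mem_nhds
      (mem_ball.2 (lt_of_le_of_ne (mem_closedBall.1 hx) (by simpa using hs)))
    have heq : r =ᶠ[𝓝 x] fun y => y + h y := by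
      filter_upwards [hnhds] with y hy
      simp [hh, truncate_of_norm_le (mem_ball_zero_iff.1 hy).le]
    have hfd : fderiv ℝ r x = 1 + fderiv ℝ h x := by
      rw [heq.fderiv_eq]
      exact ((hasFDerivAt_id x).add hd.hasFDerivAt).fderiv
    rw [← hfd]
    refine det_fderiv_eq_zero_of_norm_eventuallyEq (R := R) ?_
    filter_upwards [hnhds] with y hy using hnorm y (mem_ball_zero_iff.1 hy).le
  rw [integral_eq_zero_of_ae hdet] at hint
  exact (ENNReal.toReal_pos (measure_closedBall_pos volume (0 : Fin n → ℝ) hR).ne'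
    measure_closedBall_lt_top.ne).ne hint

/-- The **Poincaré–Miranda theorem** for continuously differentiable maps. -/
theorem exists_eq_zero_of_sign_on_faces_of_contDiff {n : ℕ} {G : (Fin n → ℝ) → (Fin n → ℝ)}
    (hG : ContDiff ℝ 1 G) (hpos : ∀ x, ‖x‖ ≤ 1 → ∀ i, x i = 1 → 0 ≤ G x i)
    (hneg : ∀ x, ‖x‖ ≤ 1 → ∀ i, x i = -1 → G x i ≤ 0) : ∃ x, ‖x‖ ≤ 1 ∧ G x = 0 := by
  by_contra! hne
  set s : (Fin n → ℝ) → ℝ := fun x => max 0 (min 1 (‖x‖ - 1)) with hs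
  have hs0 : ∀ x, 0 ≤ s x := fun x => le_max_left _ _
  have hs1 : ∀ x, s x ≤ 1 := fun x => max_le zero_le_one (min_le_left _ _)
  have hsL : LocallyLipschitz s := by
    have : LipschitzWith 1 fun x : Fin n → ℝ => ‖x‖ - 1 :=
      LipschitzWith.of_dist_le_mul fun x y => by
        simpa [dist_eq_norm, Real.norm_eq_abs] using abs_norm_sub_norm_le x y
    exact ((this.const_min 1).const_max 0).locallyLipschitz
  set H : (Fin n → ℝ) → (Fin n → ℝ) := fun x => (1 - s x) • G (truncate 1 x) + s x • x with hH
  have hHL : LocallyLipschitz H := by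
    have h1 : ContDiff ℝ 1 fun p : ℝ × ((Fin n → ℝ) × (Fin n → ℝ)) =>
        (1 - p.1) • G p.2.1 + p.1 • p.2.2 := by fun_prop
    have h2 : LocallyLipschitz fun x : Fin n → ℝ => (s x, truncate 1 x, x) :=
      hsL.prodMk ((lipschitzWith_truncate 1).locallyLipschitz.prodMk LocallyLipschitz.id)
    have h3 := h1.locallyLipschitz.comp h2
    exact h3
  have hH0 : ∀ x, H x ≠ 0 := by
    intro x hx
    rcases le_or_gt ‖x‖ 1 with h1 | h1
    · have : s x = 0 := by
        simp only [hs]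
        rw [min_eq_right (by linarith), max_eq_left (by linarith)]
      simp only [hH, this, truncate_of_norm_le h1] at hx
      exact hne x h1 (by simpa using hx)
    · have hsp : 0 < s x := lt_max_of_lt_right (lt_min one_pos (by linarith))
      obtain ⟨i, hi⟩ : ∃ i, 1 < ‖x i‖ := by
        by_contra! hall
        exact h1.not_ge ((pi_norm_le_iff_of_nonneg zero_le_one).2 hall)
      have hxi := congrFun hx i
      simp only [hH, Pi.add_apply, Pi.smul_apply, smul_eq_mul, Pi.zero_apply] at hxi
      have hmem := mem_closedBall_zero_iff.1 (truncate_mem_closedBall zero_le_one x)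
      have h1s : 0 ≤ 1 - s x := by linarith [hs1 x]
      rcases lt_abs.1 hi with hi | hi
      · have := hpos _ hmem i (by simp only [truncate]; rw [min_eq_left hi.le]; norm_num)
        nlinarith [mul_nonneg h1s this]
      · have := hneg _ hmem i
          (by simp only [truncate]; rw [min_eq_right (by linarith), max_eq_left (by linarith)])
        nlinarith [mul_nonneg h1s (neg_nonneg.2 this)]
  obtain ⟨ε, hε, hεH⟩ : ∃ ε > 0, ∀ x ∈ closedBall (0 : Fin n → ℝ) 2, ε ≤ ‖H x‖ := by
    obtain ⟨x, -, hx⟩ := (isCompact_closedBall (0 : Fin n → ℝ) 2).exists_isMinOn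
      ⟨0, by simp⟩ hHL.continuous.norm.continuousOn
    exact ⟨‖H x‖, norm_pos_iff.2 (hH0 x), fun y hy => hx hy⟩
  set N : (Fin n → ℝ) → (Fin n → ℝ) := fun y => (2 * (max ‖y‖ ε)⁻¹) • y with hN
  have hNL : LocallyLipschitz N := by
    have h1 : ContDiff ℝ 1 fun p : ℝ × (Fin n → ℝ) => (2 * p.1) • p.2 := by fun_prop
    have h2 : LipschitzWith (Real.toNNReal (ε⁻¹ * ε⁻¹))
        fun y : Fin n → ℝ => (max ‖y‖ ε)⁻¹ := by
      refine LipschitzWith.of_dist_le' fun x y => ?_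
      have hx : ε ≤ max ‖x‖ ε := le_max_right _ _
      have hy : ε ≤ max ‖y‖ ε := le_max_right _ _
      rw [dist_inv_inv₀ (hε.trans_le hx).ne' (hε.trans_le hy).ne', div_eq_inv_mul, mul_inv]
      have hd : dist (max ‖x‖ ε) (max ‖y‖ ε) ≤ dist x y := by
        simpa using (lipschitzWith_one_norm.max_const ε).dist_le_mul x y
      have hxn : ‖max ‖x‖ ε‖⁻¹ ≤ ε⁻¹ :=
        inv_anti₀ hε (by rwa [Real.norm_of_nonneg (hε.le.trans hx)])
      have hyn : ‖max ‖y‖ ε‖⁻¹ ≤ ε⁻¹ :=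
        inv_anti₀ hε (by rwa [Real.norm_of_nonneg (hε.le.trans hy)])
      gcongr
    have h3 := h1.locallyLipschitz.comp (h2.locallyLipschitz.prodMk LocallyLipschitz.id)
    exact h3
  have hNH : ∀ x, ‖x‖ ≤ 2 → N (H x) = (2 * ‖H x‖⁻¹) • H x := fun x hx => by
    simp only [hN]
    rw [max_eq_left (hεH x (by simpa using hx))]
  refine not_locallyLipschitz_retraction_closedBall (hNL.comp hHL) two_pos ?_ ?_
  · intro x hx
    rw [Function.comp_apply, hNH x hx, norm_smul, Real.norm_of_nonneg (by positivity), mul_assoc,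
      inv_mul_cancel₀ (norm_ne_zero_iff.2 (hH0 x)), mul_one]
  · intro x hx
    have h1 : H x = x := by
      have : s x = 1 := by simp only [hs, hx]; norm_num
      simp [hH, this]
    rw [Function.comp_apply, hNH x hx.le, h1, hx]
    simp

/-- Continuous maps on a compact space embedded in `V` are uniformly approximated by restrictions
of continuously differentiable maps on `V`. -/
theorem exists_contDiff_near_of_injective {Z V : Type*} [TopologicalSpace Z] [CompactSpace Z]
    [NormedAddCommGroup V] [InnerProductSpace ℝ V] {e : Z → V} (he : Continuous e)
    (hinj : Function.Injective e) {m : ℕ} {f : Z → Fin m → ℝ} (hf : Continuous f) {ε : ℝ}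
    (hε : 0 < ε) : ∃ φ : V → Fin m → ℝ, ContDiff ℝ 1 φ ∧ ∀ z, ‖φ (e z) - f z‖ < ε := by
  let A : Subalgebra ℝ C(Z, ℝ) :=
    { carrier := {g | ∃ φ : V → ℝ, ContDiff ℝ 1 φ ∧ ∀ z, g z = φ (e z)}
      mul_mem' := by
        rintro _ _ ⟨φ, hφ, h1⟩ ⟨ψ, hψ, h2⟩
        exact ⟨fun v => φ v * ψ v, hφ.mul hψ, fun z => by simp [h1, h2]⟩
      add_mem' := by
        rintro _ _ ⟨φ, hφ, h1⟩ ⟨ψ, hψ, h2⟩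
        exact ⟨fun v => φ v + ψ v, hφ.add hψ, fun z => by simp [h1, h2]⟩
      algebraMap_mem' := fun c => ⟨fun _ => c, contDiff_const, fun z => rfl⟩ }
  have hA : A.SeparatesPoints := by
    intro x y hxy
    refine ⟨_, ⟨⟨fun z => ‖e z - e x‖ ^ 2, by fun_prop⟩, ⟨fun v => ‖v - e x‖ ^ 2, ?_,
      fun z => rfl⟩, rfl⟩, ?_⟩
    · exact (contDiff_id.sub contDiff_const).norm_sq ℝ
    · simpa [sub_eq_zero, eq_comm] using hinj.ne hxy
  have key : ∀ i, ∃ φ : V → ℝ, ContDiff ℝ 1 φ ∧ ∀ z, ‖φ (e z) - f z i‖ < ε := by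
    intro i
    obtain ⟨⟨g, φ, hφ, hg⟩, h⟩ :=
      ContinuousMap.exists_mem_subalgebra_near_continuous_of_separatesPoints A hA
        (fun z => f z i) (by fun_prop) ε hε
    exact ⟨φ, hφ, fun z => by simpa [hg] using h z⟩
  choose φ hφ hφf using key
  exact ⟨fun v i => φ i v, contDiff_pi.2 hφ, fun z => (pi_norm_lt_iff hε).2 fun i => hφf i z⟩

/-- The **Poincaré–Miranda theorem** on a closed ball for the sup norm. -/
theorem exists_eq_zero_of_sign_on_faces {n : ℕ}
    {F : closedBall (0 : Fin n → ℝ) 1 → (Fin n → ℝ)} (hF : Continuous F)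
    (hpos : ∀ x i, x.1 i = 1 → 0 ≤ F x i) (hneg : ∀ x i, x.1 i = -1 → F x i ≤ 0) :
    ∃ x, F x = 0 := by
  by_contra! hne
  obtain ⟨ε, hε, hεF⟩ : ∃ ε > 0, ∀ x, ε ≤ ‖F x‖ := by
    obtain ⟨x, -, hx⟩ := isCompact_univ.exists_isMinOn
      (⟨⟨0, by simp⟩, mem_univ _⟩ : (univ : Set (closedBall (0 : Fin n → ℝ) 1)).Nonempty)
      hF.norm.continuousOn
    exact ⟨‖F x‖, norm_pos_iff.2 (hne x), fun y => hx (mem_univ y)⟩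
  obtain ⟨φ, hφ, hφF⟩ := exists_contDiff_near_of_injective
    (e := fun x : closedBall (0 : Fin n → ℝ) 1 => WithLp.toLp 2 x.1) (by fun_prop)
    (fun x y hxy => Subtype.ext (WithLp.toLp_injective 2 hxy))
    (f := fun x => F x + (ε / 3) • x.1) (by fun_prop) (show 0 < ε / 3 by positivity)
  have hsign : ∀ x i, |φ (WithLp.toLp 2 x.1) i - (F x i + ε / 3 * x.1 i)| < ε / 3 :=
    fun x i => (norm_le_pi_norm _ i).trans_lt (hφF x)
  obtain ⟨x, hx, hx0⟩ := exists_eq_zero_of_sign_on_faces_of_contDiff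
    (G := fun x => φ (WithLp.toLp 2 x)) (hφ.comp PiLp.contDiff_toLp) (fun x hx i hi => by
      have h1 := hsign ⟨x, by simpa using hx⟩ i
      have h2 := hpos ⟨x, by simpa using hx⟩ i hi
      simp only [hi] at h1
      linarith [(abs_lt.1 h1).1]) (fun x hx i hi => by
      have h1 := hsign ⟨x, by simpa using hx⟩ i
      have h2 := hneg ⟨x, by simpa using hx⟩ i hi
      simp only [hi] at h1
      linarith [(abs_lt.1 h1).2])
  have h1 := hφF ⟨x, by simpa using hx⟩
  have h2 := hεF ⟨x, by simpa using hx⟩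
  rw [hx0, zero_sub, norm_neg] at h1
  have h3 : ‖(ε / 3) • x‖ ≤ ε / 3 := by
    rw [norm_smul, Real.norm_of_nonneg (by positivity)]
    exact mul_le_of_le_one_right (by positivity) hx
  have h4 := norm_sub_le (F ⟨x, by simpa using hx⟩ + (ε / 3) • x) ((ε / 3) • x)
  rw [add_sub_cancel_right] at h4
  linarith

/-- A closed subset which embeds in a space of dimension less than `m` can be moved off zero by
an arbitrarily small perturbation of any map to `ℝ^m`. -/
theorem dense_setOf_ne_zero_on {X : Type*} [TopologicalSpace X] [CompactSpace X] [T2Space X]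
    {Z : Set X} (hZ : IsClosed Z) {V : Type*} [NormedAddCommGroup V] [InnerProductSpace ℝ V]
    [FiniteDimensional ℝ V] {e : Z → V} (he : Continuous e) (hinj : Function.Injective e) {m : ℕ}
    (hm : Module.finrank ℝ V < m) : Dense {g : C(X, Fin m → ℝ) | ∀ x ∈ Z, g x ≠ 0} := by
  have : CompactSpace Z := isCompact_iff_compactSpace.1 hZ.isCompact
  refine Metric.dense_iff.2 fun f ε hε => ?_
  obtain ⟨φ, hφ, hφf⟩ := exists_contDiff_near_of_injective he hinj
    (f := fun z : Z => f z) (by fun_prop) (show 0 < ε / 4 by positivity)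
  obtain ⟨c, hc, hcφ⟩ := Metric.dense_iff.1
    (hφ.dense_compl_range_of_finrank_lt_finrank (by simpa using hm)) 0 (ε / 4) (by positivity)
  rw [mem_ball_zero_iff] at hc
  have hd : ∀ i, ∃ d : C(X, ℝ), (∀ x, d x ∈ Icc (-(ε / 2)) (ε / 2)) ∧
      ∀ z : Z, d z = φ (e z) i - c i - f z i := by
    intro i
    let d₀ : C(Z, ℝ) := ⟨fun z => φ (e z) i - c i - f z i, by
      have := hφ.continuous
      fun_prop⟩
    have hd₀ : ∀ z, d₀ z ∈ Icc (-(ε / 2)) (ε / 2) := fun z => by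
      have h1 := abs_lt.1 ((norm_le_pi_norm _ i).trans_lt (hφf z))
      have h2 := abs_lt.1 ((norm_le_pi_norm _ i).trans_lt hc)
      simp only [Pi.sub_apply] at h1
      exact ⟨by simp only [d₀, ContinuousMap.coe_mk]; linarith,
        by simp only [d₀, ContinuousMap.coe_mk]; linarith⟩
    obtain ⟨d, hd, hdd⟩ := d₀.exists_extension_forall_mem_of_isClosedEmbedding
      hd₀ ⟨0, by constructor <;> linarith⟩ hZ.isClosedEmbedding_subtypeVal
    exact ⟨d, hd, fun z => congrFun hdd z⟩
  choose d hd hdZ using hd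
  refine ⟨f + ⟨fun x i => d i x, by fun_prop⟩, ?_, ?_⟩
  · rw [mem_ball, dist_eq_norm, add_sub_cancel_left]
    refine ((ContinuousMap.norm_le _ (by positivity : 0 ≤ ε / 2)).2 fun x => ?_).trans_lt
      (by linarith)
    exact (pi_norm_le_iff_of_nonneg (by positivity)).2 fun i => abs_le.2 (hd i x)
  · intro x hx h0
    refine hcφ ⟨e ⟨x, hx⟩, funext fun i => ?_⟩
    have h1 := congrFun h0 i
    have h2 := hdZ i ⟨x, hx⟩
    simp only [ContinuousMap.add_apply, ContinuousMap.coe_mk, Pi.add_apply, Pi.zero_apply] at h1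
    simp only at h2
    linarith

theorem isOpen_setOf_ne_zero_on {X Y : Type*} [TopologicalSpace X] [CompactSpace X]
    [TopologicalSpace Y] [T1Space Y] [Zero Y] {Z : Set X} (hZ : IsClosed Z) :
    IsOpen {g : C(X, Y) | ∀ x ∈ Z, g x ≠ 0} :=
  ContinuousMap.isOpen_setOfPred_mapsTo hZ.isCompact isOpen_compl_singleton

/-- A hypersurface `f₀ = 0` separating two opposite faces of a cube of dimension `m + 1` is not
covered by finitely many closed sets which embed in Euclidean spaces of dimension less than `m`. -/
theorem exists_eq_zero_notMem_iUnion {m k : ℕ}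
    {f₀ : closedBall (0 : Fin (m + 1) → ℝ) 1 → ℝ} (hf₀ : Continuous f₀)
    (hpos : ∀ x, x.1 0 = 1 → 0 ≤ f₀ x) (hneg : ∀ x, x.1 0 = -1 → f₀ x ≤ 0)
    {Z : Fin k → Set (closedBall (0 : Fin (m + 1) → ℝ) 1)} (hZ : ∀ i, IsClosed (Z i))
    {t : Fin k → ℕ} (ht : ∀ i, t i < m) {e : ∀ i, Z i → EuclideanSpace ℝ (Fin (t i))}
    (he : ∀ i, Continuous (e i)) (hinj : ∀ i, Function.Injective (e i)) :
    ∃ x, f₀ x = 0 ∧ x ∉ ⋃ i, Z i := by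
  have hdense := dense_iInter_of_isOpen
    (fun i => isOpen_setOf_ne_zero_on (Y := Fin m → ℝ) (hZ i))
    (fun i => dense_setOf_ne_zero_on (hZ i) (he i) (hinj i) (m := m) (by simpa using ht i))
  obtain ⟨g, hgball, hg⟩ := Metric.dense_iff.1 hdense
    ⟨fun x j => x.1 j.succ, continuous_pi fun j =>
      (continuous_apply j.succ).comp continuous_subtype_val⟩ 1 one_pos
  have hnear : ∀ x j, |g x j - x.1 j.succ| < 1 := fun x j => by
    rw [mem_ball, dist_eq_norm] at hgball
    exact (norm_le_pi_norm _ j).trans_lt ((ContinuousMap.norm_coe_le_norm _ x).trans_lt hgball)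
  obtain ⟨x, hx⟩ := exists_eq_zero_of_sign_on_faces
    (F := fun x => Fin.cons (f₀ x) (g x)) (by fun_prop)
    (fun x i hi => by
      cases i using Fin.cases with
      | zero => exact hpos x hi
      | succ j =>
        have := abs_lt.1 (hnear x j)
        rw [Fin.cons_succ]
        linarith)
    (fun x i hi => by
      cases i using Fin.cases with
      | zero => exact hneg x hi
      | succ j =>
        have := abs_lt.1 (hnear x j)
        rw [Fin.cons_succ]
        linarith)
  refine ⟨x, congrFun hx 0, fun hxZ => ?_⟩
  obtain ⟨i, hi⟩ := mem_iUnion.1 hxZ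
  exact mem_iInter.1 hg i x hi (funext fun j => by simpa using congrFun hx j.succ)

/-- A box of the shape in `exists_eq_zero_notMem_iUnion`, whose two faces in the first direction
lie close to prescribed points. -/
theorem exists_injective_faces_mem {m : ℕ} {p q : EuclideanSpace ℝ (Fin (m + 1))} (hpq : p ≠ q)
    {U W : Set (EuclideanSpace ℝ (Fin (m + 1)))} (hU : U ∈ 𝓝 p) (hW : W ∈ 𝓝 q) :
    ∃ T : (Fin (m + 1) → ℝ) → EuclideanSpace ℝ (Fin (m + 1)), Continuous T ∧
      Function.Injective T ∧ (∀ x, ‖x‖ ≤ 1 → x 0 = -1 → T x ∈ U) ∧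
      ∀ x, ‖x‖ ≤ 1 → x 0 = 1 → T x ∈ W := by
  set e₀ : Fin (m + 1) → ℝ := Pi.single 0 1 with he₀
  obtain ⟨M, hM⟩ := SeparatingDual.exists_continuousLinearEquiv_apply_eq (R := ℝ)
    (x := WithLp.toLp 2 e₀) (y := (1 / 2 : ℝ) • (q - p))
    (by simp [he₀]) (by simpa [sub_eq_zero] using hpq.symm)
  let L : (Fin (m + 1) → ℝ) → EuclideanSpace ℝ (Fin (m + 1)) :=
    fun x => M (WithLp.toLp 2 (x - x 0 • e₀))
  have hL : Continuous L := by fun_prop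
  obtain ⟨C, hC⟩ :=
    ((isCompact_closedBall (0 : Fin (m + 1) → ℝ) 1).image hL).isBounded.exists_norm_le
  have hC0 : 0 ≤ C := (norm_nonneg _).trans (hC _ ⟨0, by simp, rfl⟩)
  obtain ⟨ε₁, hε₁, hU⟩ := Metric.mem_nhds_iff.1 hU
  obtain ⟨ε₂, hε₂, hW⟩ := Metric.mem_nhds_iff.1 hW
  have hε : 0 < min ε₁ ε₂ := lt_min hε₁ hε₂
  set δ := min ε₁ ε₂ / (C + 1) with hδ
  have hδ0 : 0 < δ := by positivity
  have hsmall : ∀ x, ‖x‖ ≤ 1 → ‖δ • L x‖ < min ε₁ ε₂ := fun x hx => by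
    rw [norm_smul, Real.norm_of_nonneg hδ0.le]
    calc δ * ‖L x‖ ≤ δ * C :=
          mul_le_mul_of_nonneg_left (hC _ ⟨x, by simpa using hx, rfl⟩) hδ0.le
      _ < δ * (C + 1) := mul_lt_mul_of_pos_left (lt_add_one C) hδ0
      _ = min ε₁ ε₂ := div_mul_cancel₀ _ (by positivity)
  refine ⟨fun x => (1 / 2 : ℝ) • (p + q) + (x 0 • (1 / 2 : ℝ) • (q - p) + δ • L x), by fun_prop,
    ?_, ?_, ?_⟩
  · intro x y hxy
    have h1 : ∀ x : Fin (m + 1) → ℝ, x 0 • (1 / 2 : ℝ) • (q - p) + δ • L x =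
        M (WithLp.toLp 2 (x 0 • e₀ + δ • (x - x 0 • e₀))) := fun x => by
      simp only [L, ← hM, ← map_smul, ← map_add, WithLp.toLp_add, WithLp.toLp_smul]
    have h2 := add_left_cancel hxy
    rw [h1, h1] at h2
    have h3 := WithLp.toLp_injective 2 (M.injective h2)
    have h4 : x 0 = y 0 := by simpa [he₀] using congrFun h3 0
    rw [h4, add_right_inj] at h3
    exact sub_left_injective (smul_right_injective _ hδ0.ne' h3)
  · intro x hx hx0
    refine hU ?_
    have h1 : (1 / 2 : ℝ) • (p + q) + ((-1 : ℝ) • (1 / 2 : ℝ) • (q - p) + δ • L x) =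
        p + δ • L x := by module
    simp only [hx0]
    rw [h1, mem_ball, dist_eq_norm, add_sub_cancel_left]
    exact (hsmall x hx).trans_le (min_le_left _ _)
  · intro x hx hx0
    refine hW ?_
    have h1 : (1 / 2 : ℝ) • (p + q) + ((1 : ℝ) • (1 / 2 : ℝ) • (q - p) + δ • L x) =
        q + δ • L x := by module
    simp only [hx0]
    rw [h1, mem_ball, dist_eq_norm, add_sub_cancel_left]
    exact (hsmall x hx).trans_le (min_le_right _ _)

/-- The complement in ℝⁿ of a finite union of closed sets, each homeomorphic to an
orthant of dimension at most n − 2, is path-connected. -/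
theorem compl_union_orthants_pathConnected
    (n : ℕ) (hn : 1 ≤ n) (k : ℕ)
    (Y : Fin k → Set (EuclideanSpace ℝ (Fin n)))
    (hclosed : ∀ i, IsClosed (Y i))
    (t : Fin k → ℕ)
    (ht : ∀ i, t i + 2 ≤ n)
    (hhomeo : ∀ i, Nonempty (↥(Y i) ≃ₜ ↥(orthant (t i)))) :
    IsPathConnected ((⋃ i, Y i)ᶜ) := by
  obtain ⟨m, rfl⟩ : ∃ m, n = m + 1 := ⟨n - 1, by omega⟩
  have hX : IsClosed (⋃ i, Y i) := isClosed_iUnion_of_finite hclosed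
  have key : ∀ T : (Fin (m + 1) → ℝ) → EuclideanSpace ℝ (Fin (m + 1)), Continuous T →
      Function.Injective T → ∀ f₀ : (Fin (m + 1) → ℝ) → ℝ, Continuous f₀ →
      (∀ x, ‖x‖ ≤ 1 → x 0 = 1 → 0 ≤ f₀ x) → (∀ x, ‖x‖ ≤ 1 → x 0 = -1 → f₀ x ≤ 0) →
      ∃ x, f₀ x = 0 ∧ T x ∈ (⋃ i, Y i)ᶜ := by
    intro T hT hTinj f₀ hf₀ hpos hneg
    let S : closedBall (0 : Fin (m + 1) → ℝ) 1 → EuclideanSpace ℝ (Fin (m + 1)) := fun x => T x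
    have hS : Continuous S := hT.comp continuous_subtype_val
    have hSinj : Function.Injective S := hTinj.comp Subtype.val_injective
    obtain ⟨x, hx, hxY⟩ := exists_eq_zero_notMem_iUnion
      (hf₀.comp (continuous_subtype_val (p := (· ∈ closedBall (0 : Fin (m + 1) → ℝ) 1))))
      (fun x => hpos x (mem_closedBall_zero_iff.1 x.2))
      (fun x => hneg x (mem_closedBall_zero_iff.1 x.2))
      (Z := fun i => S ⁻¹' Y i) (fun i => (hclosed i).preimage hS) (t := t)
      (fun i => by have := ht i; omega)
      (e := fun i z => WithLp.toLp 2 ((hhomeo i).some ⟨S z, z.2⟩).1)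
      (fun i => by fun_prop) (fun i a b hab => by
        have h1 := (hhomeo i).some.injective (Subtype.ext (WithLp.toLp_injective 2 hab))
        exact Subtype.ext (hSinj (congrArg Subtype.val h1)))
    exact ⟨x, hx, by simpa [S] using hxY⟩
  refine (hX.isOpen_compl.isConnected_iff_isPathConnected).1 ⟨?_, ?_⟩
  · obtain ⟨x, -, hx⟩ := key (WithLp.toLp 2) (by fun_prop) (WithLp.toLp_injective 2)
      (fun x => x 0) (by fun_prop) (fun x _ h => by simp [h]) (fun x _ h => by simp [h])
    exact ⟨_, hx⟩
  · intro u v hu hv huv ⟨p, hpX, hpu⟩ ⟨q, hqX, hqv⟩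
    by_contra hemp
    rw [not_nonempty_iff_eq_empty] at hemp
    set A := (⋃ i, Y i)ᶜ ∩ u
    set B := (⋃ i, Y i)ᶜ ∩ v
    have hA : IsOpen A := hX.isOpen_compl.inter hu
    have hB : IsOpen B := hX.isOpen_compl.inter hv
    have hAB : ∀ x ∈ A, x ∉ B := fun x h1 h2 => by
      have : x ∈ (⋃ i, Y i)ᶜ ∩ (u ∩ v) := ⟨h1.1, h1.2, h2.2⟩
      rwa [hemp] at this
    have hpA : p ∈ A := ⟨hpX, hpu⟩
    have hqB : q ∈ B := ⟨hqX, hqv⟩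
    obtain ⟨T, hT, hTinj, hTA, hTB⟩ := exists_injective_faces_mem
      (p := p) (q := q) (by
        rintro rfl
        exact hAB p hpA hqB) (hA.mem_nhds hpA) (hB.mem_nhds hqB)
    have hfA : ∀ x ∈ A, infDist x Bᶜ = 0 := fun x hx => infDist_zero_of_mem (hAB x hx)
    have hfB : ∀ x ∈ B, infDist x Aᶜ = 0 := fun x hx =>
      infDist_zero_of_mem fun h => hAB x h hx
    have hpos : ∀ x ∈ B, 0 < infDist x Bᶜ := fun x hx =>
      (hB.isClosed_compl.notMem_iff_infDist_pos ⟨p, hAB p hpA⟩).1 (by simpa using hx)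
    have hneg : ∀ x ∈ A, 0 < infDist x Aᶜ := fun x hx =>
      (hA.isClosed_compl.notMem_iff_infDist_pos ⟨q, fun h => hAB q h hqB⟩).1 (by simpa using hx)
    obtain ⟨x, hx, hxX⟩ := key T hT hTinj
      (fun x => infDist (T x) Bᶜ - infDist (T x) Aᶜ)
      (((continuous_infDist_pt _).comp hT).sub ((continuous_infDist_pt _).comp hT))
      (fun x h1 h2 => by
        simp only [hfB _ (hTB x h1 h2), sub_zero]
        exact infDist_nonneg)
      (fun x h1 h2 => by
        simp only [hfA _ (hTA x h1 h2), zero_sub]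
        exact neg_nonpos.2 infDist_nonneg)
    rcases huv hxX with h | h
    · have hA' : T x ∈ A := ⟨hxX, h⟩
      have := hneg _ hA'
      have := hfA _ hA'
      linarith
    · have hB' : T x ∈ B := ⟨hxX, h⟩
      have := hpos _ hB'
      have := hfB _ hB'
      linarith
end

section
/- Let n ≥ 1, let O ⊆ ℝⁿ be a closed subset that is homeomorphic to the orthant [0,∞)^t for some natural number t with t ≤ n − 2, and let O′ ⊆ O be any closed subset. Then ℝⁿ ∖ O′ is path-connected. -/
open MeasureTheory Set Metric Topology Filter Module

theorem setIntegral_eq_of_polynomial {α : Type*} [MeasurableSpace α] {μ : Measure α} {s : Set α}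
    {F : ℝ → α → ℝ} {d : ℕ}
    (hpoly : ∀ x, ∃ P : Polynomial ℝ, P.natDegree ≤ d ∧ ∀ t, P.eval t = F t x)
    (hint : ∀ t, IntegrableOn (F t) s μ) {δ c : ℝ} (hδ : 0 < δ)
    (hc : ∀ t, 0 ≤ t → t ≤ δ → ∫ x in s, F t x ∂μ = c) (t : ℝ) :
    ∫ x in s, F t x ∂μ = c := by
  set v : ℕ → ℝ := fun i => δ / (i + 1) with hv
  set S := Finset.range (d + 1)
  have hinj : Set.InjOn v S := by
    intro i _ j _ hij
    have hi : (0 : ℝ) < i + 1 := by positivity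
    have hj : (0 : ℝ) < j + 1 := by positivity
    simp only [hv] at hij
    rw [div_eq_div_iff hi.ne' hj.ne', mul_right_inj' hδ.ne'] at hij
    exact_mod_cast (add_right_cancel hij).symm
  have key : ∀ x, F t x = ∑ i ∈ S, F (v i) x * (Lagrange.basis S v i).eval t := by
    intro x
    obtain ⟨P, hPd, hP⟩ := hpoly x
    have hdeg : P.degree < S.card := by
      refine lt_of_le_of_lt P.degree_le_natDegree ?_
      simp only [S, Finset.card_range]
      exact_mod_cast Nat.lt_succ_of_le hPd
    rw [← hP t]
    conv_lhs => rw [Lagrange.eq_interpolate hinj hdeg]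
    simp [Lagrange.interpolate_apply, Polynomial.eval_finsetSum, hP]
  have hvmem : ∀ i, ∫ x in s, F (v i) x ∂μ = c := fun i => by
    apply hc
    · positivity
    · exact div_le_self hδ.le (by linarith [(Nat.cast_nonneg i : (0 : ℝ) ≤ i)])
  simp_rw [key]
  rw [integral_finsetSum _ fun i _ => (hint (v i)).mul_const _]
  simp_rw [integral_mul_const, hvmem, ← Finset.mul_sum, ← Polynomial.eval_finsetSum]
  rw [Lagrange.sum_basis hinj (by simp [S])]
  simp

variable {E : Type*} [NormedAddCommGroup E] [InnerProductSpace ℝ E] [FiniteDimensional ℝ E]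

theorem exists_polynomial_eval_det_one_add_smul (A : E →L[ℝ] E) :
    ∃ P : Polynomial ℝ, P.natDegree ≤ finrank ℝ E ∧ ∀ t, P.eval t = (1 + t • A).det := by
  let b := finBasis ℝ E
  let m := LinearMap.toMatrix b b (A : E →ₗ[ℝ] E)
  refine ⟨((Polynomial.X : Polynomial ℝ) • m.map Polynomial.C
    + (1 : Matrix _ _ ℝ).map Polynomial.C).det, ?_, fun t => ?_⟩
  · simpa using Polynomial.natDegree_det_X_add_C_le m 1
  · have : (1 + t • A).det = LinearMap.det ((1 + t • A : E →L[ℝ] E) : E →ₗ[ℝ] E) := rfl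
    rw [this, ← LinearMap.det_toMatrix b, ← Polynomial.coe_evalRingHom, RingHom.map_det]
    congr 1
    ext i j
    simp [m, Matrix.one_apply, LinearMap.toMatrix_apply, Finsupp.single_apply, add_comm,
      apply_ite (Polynomial.eval t), eq_comm]
    exact mul_comm _ _

theorem exists_polynomial_eval_weight (A : E →L[ℝ] E) (x v : E) (M : ℝ) (k : ℕ) :
    ∃ P : Polynomial ℝ, P.natDegree ≤ k * 2 + finrank ℝ E ∧
      ∀ t, P.eval t = (M - ‖x + t • v‖ ^ 2) ^ k * (1 + t • A).det := by
  obtain ⟨P, hPd, hP⟩ := exists_polynomial_eval_det_one_add_smul A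
  refine ⟨(Polynomial.C (-‖v‖ ^ 2) * Polynomial.X ^ 2 +
    Polynomial.C (-2 * inner ℝ x v) * Polynomial.X + Polynomial.C (M - ‖x‖ ^ 2)) ^ k * P,
    ?_, fun t => ?_⟩
  · refine Polynomial.natDegree_mul_le.trans (add_le_add ?_ hPd)
    exact Polynomial.natDegree_pow_le.trans
      (Nat.mul_le_mul_left _ Polynomial.natDegree_quadratic_le)
  · simp only [Polynomial.eval_mul, Polynomial.eval_pow, Polynomial.eval_add, Polynomial.eval_C,
      Polynomial.eval_X, hP]
    rw [norm_add_sq_real, norm_smul, inner_smul_right, mul_pow, Real.norm_eq_abs, sq_abs]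
    ring

theorem det_one_add_pos_of_norm_lt_one (A : E →L[ℝ] E) (hA : ‖A‖ < 1) : 0 < (1 + A).det := by
  have hcont : Continuous fun s : ℝ => (1 + s • A).det :=
    ContinuousLinearMap.continuous_det.comp (by fun_prop)
  have hne : ∀ s ∈ Icc (0 : ℝ) 1, (1 + s • A).det ≠ 0 := by
    intro s hs h0
    have hu : IsUnit (1 + s • A) := by
      have := isUnit_one_sub_of_norm_lt_one (x := -(s • A)) (by
        rw [norm_neg, norm_smul, Real.norm_of_nonneg hs.1]
        nlinarith [norm_nonneg A, hs.1, hs.2])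
      simpa using this
    have h1 := (hu.map (ContinuousLinearMap.toLinearMapRingHom (R₁ := ℝ) (M₁ := E)))
    exact (LinearMap.isUnit_iff_isUnit_det _ |>.1 h1).ne_zero h0
  by_contra! hneg
  have h0 : (1 + (0 : ℝ) • A).det = 1 := by
    have : (1 + (0 : ℝ) • A).det = LinearMap.det ((1 + (0:ℝ) • A : E →L[ℝ] E) : E →ₗ[ℝ] E) := rfl
    rw [this]; simp
  obtain ⟨s, hs, hs0⟩ := intermediate_value_Icc' zero_le_one hcont.continuousOn
    (show (0 : ℝ) ∈ Icc _ _ from ⟨by simpa using hneg, by simp only [h0]; exact zero_le_one⟩)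
  exact hne s hs hs0

theorem bijective_add_smul {g : E → E} {L : NNReal} (hL : LipschitzWith L g) {t : ℝ}
    (ht0 : 0 ≤ t) (ht : t * L < 1) : Function.Bijective fun x => x + t • g x := by
  have happ : ApproximatesLinearOn (fun x => x + t • g x)
      ((ContinuousLinearEquiv.refl ℝ E : E ≃L[ℝ] E) : E →L[ℝ] E) univ (t.toNNReal * L) := by
    intro x _ y _
    have : x + t • g x - (y + t • g y)
        - ((ContinuousLinearEquiv.refl ℝ E : E ≃L[ℝ] E) : E →L[ℝ] E) (x - y)
        = t • (g x - g y) := by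
      simp only [ContinuousLinearEquiv.coe_refl, ContinuousLinearMap.id_apply, smul_sub]; abel
    rw [this, norm_smul, Real.norm_of_nonneg ht0, NNReal.coe_mul, Real.coe_toNNReal _ ht0,
      mul_assoc]
    exact mul_le_mul_of_nonneg_left (hL.norm_sub_le x y) ht0
  have hc : Subsingleton E ∨ t.toNNReal * L <
      ‖((ContinuousLinearEquiv.refl ℝ E).symm : E →L[ℝ] E)‖₊⁻¹ := by
    rcases subsingleton_or_nontrivial E with h | h
    · exact Or.inl h
    · right
      have : ‖((ContinuousLinearEquiv.refl ℝ E).symm : E →L[ℝ] E)‖₊ = 1 := by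
        ext; simp
      rw [this, inv_one, ← NNReal.coe_lt_coe, NNReal.coe_mul, Real.coe_toNNReal _ ht0]
      simpa using ht
  exact (happ.toHomeomorph _ hc).bijective

theorem image_closedBall_eq_of_bijective {E : Type*} [NormedAddCommGroup E] {f : E → E} {R : ℝ} (hf : Function.Bijective f)
    (hR : ∀ x, R < ‖x‖ → f x = x) : f '' closedBall 0 R = closedBall 0 R := by
  ext y
  simp only [mem_image, mem_closedBall_zero_iff]
  constructor
  · rintro ⟨x, hx, rfl⟩
    by_contra! h
    have := hf.1 (hR _ h)
    rw [this] at h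
    linarith
  · intro hy
    obtain ⟨x, rfl⟩ := hf.2 y
    refine ⟨x, ?_, rfl⟩
    by_contra! h
    rw [hR x h] at hy
    linarith

variable [MeasurableSpace E] [BorelSpace E]

theorem setIntegral_weight_mul_det_eq {g : E → E} (hg : ContDiff ℝ 1 g) {R : ℝ}
    (hR : ∀ x, R < ‖x‖ → g x = 0) (M : ℝ) (k : ℕ) (μ : Measure E) [μ.IsAddHaarMeasure] (t : ℝ) :
    ∫ x in closedBall 0 R, (M - ‖x + t • g x‖ ^ 2) ^ k * (1 + t • fderiv ℝ g x).det ∂μ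
      = ∫ x in closedBall (0 : E) R, (M - ‖x‖ ^ 2) ^ k ∂μ := by
  have hsupp : HasCompactSupport g := HasCompactSupport.intro (isCompact_closedBall (0 : E) R)
    fun x hx => hR x (by simpa using hx)
  obtain ⟨L, hL⟩ := hg.lipschitzWith_of_hasCompactSupport hsupp one_ne_zero
  have hg' : Continuous (fderiv ℝ g) := hg.continuous_fderiv one_ne_zero
  refine setIntegral_eq_of_polynomial
    (F := fun t x => (M - ‖x + t • g x‖ ^ 2) ^ k * (1 + t • fderiv ℝ g x).det)
    (fun x => exists_polynomial_eval_weight (fderiv ℝ g x) x (g x) M k) (fun t => ?_)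
    (δ := 1 / (L + 1)) (by positivity) (fun t ht0 ht => ?_) t
  · refine ContinuousOn.integrableOn_compact (isCompact_closedBall _ _)
      (Continuous.continuousOn ?_)
    have := hg.continuous
    exact (by fun_prop : Continuous fun x => (M - ‖x + t • g x‖ ^ 2) ^ k).mul
      (ContinuousLinearMap.continuous_det.comp (by fun_prop))
  · have htL : t * L < 1 := by
      have h1 : (0 : ℝ) < L + 1 := by positivity
      rw [le_div_iff₀ h1] at ht
      rcases ht0.eq_or_lt with h | h
      · rw [← h]; simp
      · linarith
    have hbij := bijective_add_smul hL ht0 htL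
    have himg := image_closedBall_eq_of_bijective hbij (R := R) fun x hx => by simp [hR x hx]
    have hderiv : ∀ x ∈ closedBall (0 : E) R, HasFDerivWithinAt (fun x => x + t • g x)
        (1 + t • fderiv ℝ g x) (closedBall 0 R) x := fun x _ =>
      ((hasFDerivAt_id x).add
        (((hg.differentiable one_ne_zero) x).hasFDerivAt.const_smul t)).hasFDerivWithinAt
    have hcv := integral_image_eq_integral_abs_det_fderiv_smul μ
      isClosed_closedBall.measurableSet hderiv hbij.1.injOn fun y => (M - ‖y‖ ^ 2) ^ k
    rw [himg] at hcv
    rw [hcv]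
    refine setIntegral_congr_fun isClosed_closedBall.measurableSet fun x _ => ?_
    have hdet : 0 < (1 + t • fderiv ℝ g x).det := by
      apply det_one_add_pos_of_norm_lt_one
      rw [norm_smul, Real.norm_of_nonneg ht0]
      exact (mul_le_mul_of_nonneg_left (norm_fderiv_le_of_lipschitz ℝ hL) ht0).trans_lt htL
    simp only [abs_of_pos hdet, smul_eq_mul]
    ring

theorem exists_add_eq_zero_of_contDiff {g : E → E} (hg : ContDiff ℝ 1 g) {R : ℝ}
    (hR : ∀ x, R < ‖x‖ → g x = 0) : ∃ x, x + g x = 0 := by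
  by_contra! hne
  set R' := max R 1
  have hR'0 : 0 < R' := lt_max_of_lt_right one_pos
  have hR' : ∀ x, R' < ‖x‖ → g x = 0 := fun x hx => hR x ((le_max_left _ _).trans_lt hx)
  have hgc := hg.continuous
  have hg' : Continuous (fderiv ℝ g) := hg.continuous_fderiv one_ne_zero
  set B := closedBall (0 : E) R'
  have hB : IsCompact B := isCompact_closedBall _ _
  have hB0 : B.Nonempty := nonempty_closedBall.2 hR'0.le
  have hnorm : Continuous fun x => ‖x + g x‖ := by fun_prop
  obtain ⟨x₀, hx₀B, hx₀⟩ := hB.exists_isMinOn hB0 hnorm.continuousOn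
  obtain ⟨x₁, -, hx₁⟩ := hB.exists_isMaxOn hB0 hnorm.continuousOn
  set ε := ‖x₀ + g x₀‖
  have hε : 0 < ε := norm_pos_iff.2 (hne x₀)
  set M := max (‖x₁ + g x₁‖ ^ 2) (R' ^ 2)
  have hdetc : Continuous fun x => |(1 + fderiv ℝ g x).det| :=
    (ContinuousLinearMap.continuous_det.comp (by fun_prop)).abs
  obtain ⟨x₂, -, hx₂⟩ := hB.exists_isMaxOn hB0 hdetc.continuousOn
  set C := |(1 + fderiv ℝ g x₂).det|
  set η := min ε R' / 2
  have hη : 0 < η := by positivity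
  have hηε : η < ε := (half_lt_self (by positivity)).trans_le (min_le_left _ _)
  have hηR : η < R' := (half_lt_self (by positivity)).trans_le (min_le_right _ _)
  let μ : Measure E := volume
  have ha : 0 ≤ M - ε ^ 2 := by
    have h1 : ε ≤ ‖x₁ + g x₁‖ := hx₁ hx₀B
    have h2 : ε ^ 2 ≤ ‖x₁ + g x₁‖ ^ 2 := by gcongr
    linarith [le_max_left (‖x₁ + g x₁‖ ^ 2) (R' ^ 2)]
  have hab : M - ε ^ 2 < M - η ^ 2 := by
    have : η ^ 2 < ε ^ 2 := by gcongr
    linarith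
  have hupper : ∀ k : ℕ, ∫ x in B, (M - ‖x‖ ^ 2) ^ k ∂μ ≤ (M - ε ^ 2) ^ k * C * μ.real B := by
    intro k
    rw [← setIntegral_weight_mul_det_eq hg hR' M k μ 1]
    refine (le_abs_self _).trans ?_
    rw [← Real.norm_eq_abs]
    refine norm_setIntegral_le_of_norm_le_const hB.measure_lt_top fun x hx => ?_
    have h1 : ε ≤ ‖x + g x‖ := hx₀ hx
    have h2 : ‖x + g x‖ ≤ ‖x₁ + g x₁‖ := hx₁ hx
    have h3 : |(1 + fderiv ℝ g x).det| ≤ C := hx₂ hx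
    have h4 : ε ^ 2 ≤ ‖x + g x‖ ^ 2 := by gcongr
    have h5 : ‖x + g x‖ ^ 2 ≤ M := (by gcongr : ‖x + g x‖ ^ 2 ≤ _).trans (le_max_left _ _)
    rw [one_smul, one_smul, norm_mul, norm_pow, Real.norm_of_nonneg (by linarith),
      Real.norm_eq_abs]
    gcongr
  have hlower : ∀ k : ℕ, (M - η ^ 2) ^ k * μ.real (ball (0 : E) η)
      ≤ ∫ x in B, (M - ‖x‖ ^ 2) ^ k ∂μ := by
    intro k
    have hcont : Continuous fun x : E => (M - ‖x‖ ^ 2) ^ k := by fun_prop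
    have hint : IntegrableOn (fun x : E => (M - ‖x‖ ^ 2) ^ k) B μ :=
      hcont.continuousOn.integrableOn_compact hB
    have hsub : ball (0 : E) η ⊆ B :=
      ball_subset_closedBall.trans (closedBall_subset_closedBall hηR.le)
    calc (M - η ^ 2) ^ k * μ.real (ball (0 : E) η)
        = ∫ x in ball (0 : E) η, (M - η ^ 2) ^ k ∂μ := by simp [mul_comm]
      _ ≤ ∫ x in ball (0 : E) η, (M - ‖x‖ ^ 2) ^ k ∂μ := by
        refine setIntegral_mono_on (by simp [measure_ball_lt_top]) (hint.mono_set hsub)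
          isOpen_ball.measurableSet fun x hx => ?_
        have hx' : ‖x‖ ≤ η := (mem_ball_zero_iff.1 hx).le
        gcongr
        linarith
      _ ≤ _ := by
        refine setIntegral_mono_set hint ?_ hsub.eventuallyLE
        refine (ae_restrict_iff' hB.measurableSet).2 (Eventually.of_forall fun x hx => ?_)
        have hx' : ‖x‖ ≤ R' := mem_closedBall_zero_iff.1 hx
        have h2 : ‖x‖ ^ 2 ≤ R' ^ 2 := by gcongr
        have h3 : R' ^ 2 ≤ M := le_max_right _ _
        simp only [Pi.zero_apply]
        exact pow_nonneg (by linarith) k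
  have hball : 0 < μ.real (ball (0 : E) η) :=
    ENNReal.toReal_pos (measure_ball_pos μ _ hη).ne' measure_ball_lt_top.ne
  have hb : 0 < M - η ^ 2 := ha.trans_lt hab
  have hlim : Tendsto (fun k : ℕ => ((M - ε ^ 2) / (M - η ^ 2)) ^ k * (C * μ.real B)) atTop
      (𝓝 (0 * (C * μ.real B))) :=
    (tendsto_pow_atTop_nhds_zero_of_lt_one (by positivity) ((div_lt_one hb).2 hab)).mul_const _
  rw [zero_mul] at hlim
  obtain ⟨k, hk⟩ := (hlim.eventually (gt_mem_nhds hball)).exists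
  have h := (hlower k).trans (hupper k)
  rw [div_pow, div_mul_eq_mul_div, div_lt_iff₀ (by positivity)] at hk
  linarith

theorem exists_eq_zero_of_continuous {E : Type*} [NormedAddCommGroup E] [InnerProductSpace ℝ E]
    [FiniteDimensional ℝ E] {f : E → E} (hf : Continuous f) {R : ℝ}
    (hR : ∀ x, R < ‖x‖ → f x = x) : ∃ x, f x = 0 := by
  by_contra! hne
  borelize E
  obtain ⟨x₀, -, hx₀⟩ := (isCompact_closedBall (0 : E) (max R 1)).exists_isMinOn
    (nonempty_closedBall.2 (zero_le_one.trans (le_max_right _ _))) hf.norm.continuousOn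
  have hε : 0 < min ‖f x₀‖ 1 := lt_min (norm_pos_iff.2 (hne x₀)) one_pos
  have hbound : ∀ x, min ‖f x₀‖ 1 ≤ ‖f x‖ := by
    intro x
    by_cases hx : ‖x‖ ≤ max R 1
    · exact (min_le_left _ _).trans (hx₀ (mem_closedBall_zero_iff.2 hx))
    · obtain ⟨h1, h2⟩ := max_lt_iff.1 (not_le.1 hx)
      rw [hR x h1]
      exact (min_le_right _ _).trans h2.le
  obtain ⟨g, hg, hgf, hsupp⟩ := (hf.sub continuous_id).exists_contDiff_approx 1
    (ε := fun _ => min ‖f x₀‖ 1) continuous_const fun _ => hε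
  obtain ⟨x, hx⟩ := exists_add_eq_zero_of_contDiff (R := R) hg fun x hx => by
    by_contra h
    exact hsupp h (by simp [hR x hx])
  refine (hgf x).not_ge ((hbound x).trans_eq ?_)
  have : g x = -x := by rw [eq_neg_iff_add_eq_zero, add_comm, hx]
  rw [dist_eq_norm', this]
  simp

theorem exists_continuousMap_ne_zero_dist_lt {X E F : Type*} [TopologicalSpace X] [NormalSpace X]
    [T2Space X] [NormedAddCommGroup E] [NormedSpace ℝ E] [FiniteDimensional ℝ E]
    [NormedAddCommGroup F] [NormedSpace ℝ F] [FiniteDimensional ℝ F]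
    (hFE : finrank ℝ F < finrank ℝ E) {K : Set X} (hK : IsCompact K) {j : X → F}
    (hj : ContinuousOn j K) (hjinj : InjOn j K) {f : X → E} (hf : ContinuousOn f K)
    {ε : ℝ} (hε : 0 < ε) :
    ∃ N : C(X, E), (∀ x, N x ≠ 0) ∧ ∀ x ∈ K, dist (N x) (f x) < ε := by
  have : CompactSpace K := isCompact_iff_compactSpace.1 hK
  have hjK : IsClosedEmbedding (K.domRestrict j) :=
    hj.domRestrict.isClosedEmbedding hjinj.injective
  obtain ⟨J, hJ⟩ := ContinuousMap.exists_extension' hK.isClosed.isClosedEmbedding_subtypeVal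
    ⟨K.domRestrict j, hj.domRestrict⟩
  obtain ⟨G, hG⟩ := ContinuousMap.exists_extension' hjK ⟨K.domRestrict f, hf.domRestrict⟩
  obtain ⟨S, hS, hSG, -⟩ := G.continuous.exists_contDiff_approx 1 (ε := fun _ => ε / 2)
    continuous_const fun _ => half_pos hε
  obtain ⟨w, hw, hwε⟩ := (hS.dense_compl_range_of_finrank_lt_finrank hFE).exists_dist_lt 0
    (half_pos hε)
  refine ⟨⟨fun x => S (J x) - w, (hS.continuous.comp J.continuous).sub continuous_const⟩,
    fun x h => hw ⟨J x, sub_eq_zero.1 h⟩, fun x hx => ?_⟩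
  have hJx : J x = j x := congrFun hJ ⟨x, hx⟩
  have hGx : G (j x) = f x := congrFun hG ⟨x, hx⟩
  have h1 := hSG (j x)
  rw [hGx] at h1
  have h2 : dist (S (j x) - w) (S (j x)) < ε / 2 := by
    rw [dist_eq_norm]; simpa using hwε
  simp only [ContinuousMap.coe_mk, hJx]
  linarith [dist_triangle (S (j x) - w) (S (j x)) (f x)]

theorem not_isBounded_of_frontier_subset {E F : Type*} [NormedAddCommGroup E]
    [InnerProductSpace ℝ E] [FiniteDimensional ℝ E]
    [NormedAddCommGroup F] [NormedSpace ℝ F] [FiniteDimensional ℝ F]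
    (hFE : finrank ℝ F < finrank ℝ E) {K V : Set E} (hK : IsCompact K) {j : E → F}
    (hj : ContinuousOn j K) (hjinj : InjOn j K) (hVK : frontier V ⊆ K) {p : E}
    (hpV : p ∈ V) (hpK : p ∉ K) : ¬ Bornology.IsBounded V := by
  intro hV
  obtain ⟨ε, hε, hεK⟩ := Metric.isOpen_iff.1 hK.isClosed.isOpen_compl p hpK
  obtain ⟨N, hN0, hN⟩ := exists_continuousMap_ne_zero_dist_lt hFE hK hj hjinj
    (f := fun x => x - p) (by fun_prop) hε
  set W := {x : E | dist (N x) (x - p) < ‖x - p‖}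
  have hW : IsOpen W := isOpen_lt (by fun_prop) (by fun_prop)
  have hKW : K ⊆ W := fun x hx => (hN x hx).trans_le <| by
    by_contra! h
    exact hεK (mem_ball_iff_norm.2 h) hx
  obtain ⟨l, hl0, hl1, hl⟩ := exists_continuous_zero_one_of_isClosed hK.isClosed
    hW.isClosed_compl (disjoint_compl_right.mono_left hKW)
  classical
  let Φ : E → E := fun x => if x ∈ V then (x - p) + l x • (N x - (x - p)) else x - p
  have hΦ : Continuous Φ := by
    refine Continuous.if (fun a ha => ?_) (by fun_prop) (by fun_prop)
    simp [hl0 (hVK ha)]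
  obtain ⟨R, hR⟩ := hV.subset_closedBall p
  obtain ⟨y, hy⟩ := exists_eq_zero_of_continuous (f := fun y => Φ (p + y)) (R := R) (by fun_prop)
    fun y hy => by
      have : p + y ∉ V := fun h => hy.not_ge (by simpa using hR h)
      simp [Φ, this]
  simp only [Φ] at hy
  set x := p + y
  split_ifs at hy with hxV
  · by_cases hxW : x ∈ W
    · have h1 : x - p = -(l x • (N x - (x - p))) := eq_neg_of_add_eq_zero_left hy
      have h2 := congrArg norm h1
      rw [norm_neg, norm_smul, Real.norm_of_nonneg (hl x).1] at h2
      have h3 : ‖N x - (x - p)‖ < ‖x - p‖ := by rw [← dist_eq_norm]; exact hxW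
      nlinarith [(hl x).2, norm_nonneg (N x - (x - p))]
    · rw [hl1 hxW] at hy
      exact hN0 x (by simpa using hy)
  · exact hxV (sub_eq_zero.1 hy ▸ hpV)

/-- An embedding `W → W × ℝ` extending continuously to the one-point compactification by `∞ ↦ 0`. -/
noncomputable def onePointEmbedding (W : Type*) [NormedAddCommGroup W] [NormedSpace ℝ W] (w : W) :
    W × ℝ :=
  (1 + ‖w‖ ^ 2)⁻¹ • (w, 1)

section onePointEmbedding

variable {W : Type*} [NormedAddCommGroup W] [NormedSpace ℝ W]

theorem onePointEmbedding_ne_zero (w : W) : onePointEmbedding W w ≠ 0 := fun h => by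
  have h2 := congrArg Prod.snd h
  simp only [onePointEmbedding, Prod.smul_mk, Prod.snd_zero, smul_eq_mul, mul_one] at h2
  have : (0 : ℝ) < (1 + ‖w‖ ^ 2)⁻¹ := by positivity
  exact this.ne' h2

theorem onePointEmbedding_injective : Function.Injective (onePointEmbedding W) := by
  intro w w' h
  simp only [onePointEmbedding, Prod.smul_mk, Prod.mk.injEq, smul_eq_mul, mul_one] at h
  obtain ⟨h1, h2⟩ := h
  rw [h2] at h1
  have : (0 : ℝ) < (1 + ‖w'‖ ^ 2)⁻¹ := by positivity
  exact smul_right_injective W this.ne' h1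

theorem continuous_onePointEmbedding : Continuous (onePointEmbedding W) := by
  unfold onePointEmbedding
  have hden : Continuous fun w : W => (1 + ‖w‖ ^ 2)⁻¹ :=
    Continuous.inv₀ (by fun_prop) fun w => by positivity
  exact hden.smul (by fun_prop)

theorem tendsto_onePointEmbedding [ProperSpace W] :
    Tendsto (onePointEmbedding W) (cocompact W) (𝓝 0) := by
  have hlim : Tendsto (fun w : W => (1 + ‖w‖)⁻¹ * 2) (cocompact W) (𝓝 (0 * 2)) :=
    (tendsto_inv_atTop_zero.comp
      (tendsto_atTop_add_const_left _ 1 (tendsto_norm_cocompact_atTop))).mul_const 2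
  rw [zero_mul] at hlim
  refine squeeze_zero_norm (fun w => ?_) hlim
  have h0 := norm_nonneg w
  have hw : ‖(w, (1 : ℝ))‖ ≤ 1 + ‖w‖ := by
    rw [Prod.norm_mk, norm_one]; exact max_le (by linarith) (by linarith)
  rw [onePointEmbedding, norm_smul, Real.norm_of_nonneg (by positivity)]
  calc (1 + ‖w‖ ^ 2)⁻¹ * ‖(w, (1 : ℝ))‖ ≤ (1 + ‖w‖ ^ 2)⁻¹ * (1 + ‖w‖) := by gcongr
    _ ≤ (1 + ‖w‖)⁻¹ * 2 := by
      rw [inv_mul_eq_div, inv_mul_eq_div, div_le_div_iff₀ (by positivity) (by positivity)]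
      nlinarith [sq_nonneg (‖w‖ - 1)]

end onePointEmbedding

open EuclideanGeometry in
theorem mem_closure_of_frontier_subset {E W : Type*} [NormedAddCommGroup E]
    [InnerProductSpace ℝ E] [FiniteDimensional ℝ E]
    [NormedAddCommGroup W] [NormedSpace ℝ W] [FiniteDimensional ℝ W]
    (hWE : finrank ℝ W + 1 < finrank ℝ E) {A U : Set E} (hA : IsClosed A) {h : E → W}
    (hcont : ContinuousOn h A) (hinj : InjOn h A)
    (hproper : Tendsto h (cocompact E ⊓ 𝓟 A) (cocompact W)) (hUA : frontier U ⊆ A)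
    {p : E} (hpU : p ∈ U) (hpA : p ∉ A) {q : E} (hqA : q ∉ A) : q ∈ closure U := by
  by_contra hqU
  set ι : E → E := inversion q 1
  have hιι : ∀ x, ι (ι x) = x := inversion_inversion q one_ne_zero
  have hιq : ι q = q := inversion_self q 1
  have hιc : ∀ x, x ≠ q → ContinuousAt ι x := fun x hx =>
    continuousAt_const.inversion continuousAt_const continuousAt_id hx
  have hbdd : ∀ S : Set E, q ∉ closure S → Bornology.IsBounded (ι ⁻¹' S) := by
    intro S hS
    obtain ⟨r, hr, hrS⟩ := Metric.isOpen_iff.1 isClosed_closure.isOpen_compl q hS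
    refine (isBounded_closedBall (x := q) (r := 1 / r)).subset fun x hx => ?_
    have h1 : r ≤ dist (ι x) q := by
      by_contra! hlt
      exact hrS hlt (subset_closure hx)
    rw [dist_inversion_center, one_pow, le_one_div hr
      (dist_pos.2 fun hxq => hS (subset_closure (by rw [mem_preimage, hxq, hιq] at hx; exact hx)))]
      at h1
    exact h1
  set K : Set E := insert q (ι ⁻¹' A)
  have hK : IsCompact K := by
    refine isCompact_of_isClosed_isBounded ?_
      (Bornology.IsBounded.insert (hbdd A (by rwa [hA.closure_eq])) q)
    rw [← isOpen_compl_iff, isOpen_iff_mem_nhds]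
    intro x hx
    simp only [K, mem_compl_iff, mem_insert_iff, not_or] at hx
    filter_upwards [isOpen_ne.mem_nhds hx.1, (hιc x hx.1).preimage_mem_nhds
      (hA.isOpen_compl.mem_nhds hx.2)] with y hy1 hy2
    simp only [K, mem_compl_iff, mem_insert_iff, not_or]
    exact ⟨hy1, hy2⟩
  have hmapsK : MapsTo ι (K \ {q}) A := fun x hx => hx.1.resolve_left hx.2
  classical
  let j : E → W × ℝ := fun x => if x = q then 0 else onePointEmbedding W (h (ι x))
  have hjeq : ∀ x, x ≠ q → j x = onePointEmbedding W (h (ι x)) := fun x hx => if_neg hx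
  have hjq : j q = 0 := if_pos rfl
  have hj : ContinuousOn j K := by
    intro x hx
    by_cases hxq : x = q
    · subst hxq
      rw [← continuousWithinAt_sdiff_self, ContinuousWithinAt, hjq]
      have hι : Tendsto ι (𝓝[K \ {x}] x) (cocompact E) := by
        rw [← Metric.cobounded_eq_cocompact, ← comap_dist_right_atTop x, tendsto_comap_iff]
        have : (fun y => dist y x) ∘ ι = fun y => (dist y x)⁻¹ := by
          ext y; simp [ι, dist_inversion_center]
        rw [this]
        refine tendsto_inv_nhdsGT_zero.comp (tendsto_nhdsWithin_iff.2 ⟨?_, ?_⟩)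
        · exact tendsto_nhdsWithin_of_tendsto_nhds
            ((continuous_id.dist continuous_const).tendsto' x 0 (dist_self x))
        · filter_upwards [self_mem_nhdsWithin] with y hy using dist_pos.2 hy.2
      have hι' : Tendsto ι (𝓝[K \ {x}] x) (cocompact E ⊓ 𝓟 A) :=
        tendsto_inf.2 ⟨hι, tendsto_principal.2 <| by
          filter_upwards [self_mem_nhdsWithin] with y hy using hmapsK hy⟩
      refine (tendsto_onePointEmbedding.comp (hproper.comp hι')).congr' ?_
      filter_upwards [self_mem_nhdsWithin] with y hy using (hjeq y hy.2).symm
    · rw [← continuousWithinAt_sdiff_singleton (y := q)]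
      refine ContinuousWithinAt.congr (f := fun x => onePointEmbedding W (h (ι x))) ?_
        (fun y hy => hjeq y hy.2) (hjeq x hxq)
      exact continuous_onePointEmbedding.continuousAt.comp_continuousWithinAt
        ((hcont (ι x) (hmapsK ⟨hx, hxq⟩)).comp (hιc x hxq).continuousWithinAt hmapsK)
  have hjinj : InjOn j K := by
    intro x hx y hy hxy
    by_cases hxq : x = q <;> by_cases hyq : y = q
    · rw [hxq, hyq]
    · rw [hxq, hjq, hjeq y hyq] at hxy
      exact absurd hxy.symm (onePointEmbedding_ne_zero _)
    · rw [hyq, hjq, hjeq x hxq] at hxy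
      exact absurd hxy (onePointEmbedding_ne_zero _)
    · rw [hjeq x hxq, hjeq y hyq] at hxy
      exact (inversion_injective q one_ne_zero) (hinj (hmapsK ⟨hx, hxq⟩) (hmapsK ⟨hy, hyq⟩)
        (onePointEmbedding_injective hxy))
  have hVK : frontier (ι ⁻¹' U) ⊆ K := by
    intro x hx
    by_cases hxq : x = q
    · exact Or.inl hxq
    · refine Or.inr (hUA ?_)
      rw [frontier_eq_closure_inter_closure] at hx ⊢
      have key : ∀ S : Set E, x ∈ closure (ι ⁻¹' S) → ι x ∈ closure S := fun S hS =>
        closure_mono (image_preimage_subset ι S)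
          (((hιc x hxq).continuousWithinAt).mem_closure_image hS)
      exact ⟨key _ hx.1, key _ hx.2⟩
  have hpq : p ≠ q := fun hpq => hqU (hpq ▸ subset_closure hpU)
  refine not_isBounded_of_frontier_subset (F := W × ℝ) (by simpa using hWE) hK hj hjinj hVK
    (p := ι p) (by rwa [mem_preimage, hιι]) ?_ (hbdd U hqU)
  rintro (hp | hp)
  · exact hpq (by rw [← hιι p, hp, hιq])
  · rw [mem_preimage, hιι] at hp
    exact hpA hp

theorem isPreconnected_compl_of_isClosedEmbedding {E W : Type*} [NormedAddCommGroup E]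
    [InnerProductSpace ℝ E] [FiniteDimensional ℝ E]
    [NormedAddCommGroup W] [NormedSpace ℝ W] [FiniteDimensional ℝ W]
    (hWE : finrank ℝ W + 1 < finrank ℝ E) {A : Set E} (hA : IsClosed A) {e : A → W}
    (he : IsClosedEmbedding e) : IsPreconnected Aᶜ := by
  have hext : ∀ x : A, Function.extend Subtype.val e 0 (x : E) = e x := fun x =>
    Subtype.val_injective.extend_apply e 0 x
  have hcomp : Function.extend Subtype.val e 0 ∘ (Subtype.val : A → E) = e := funext hext
  have hcont : ContinuousOn (Function.extend Subtype.val e 0 : E → W) A := by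
    rw [continuousOn_iff_continuous_domRestrict, domRestrict_eq, hcomp]
    exact he.continuous
  have hinj : InjOn (Function.extend Subtype.val e 0 : E → W) A := by
    rw [injOn_iff_injective, domRestrict_eq, hcomp]
    exact he.injective
  have hproper : Tendsto (Function.extend Subtype.val e 0 : E → W) (cocompact E ⊓ 𝓟 A)
      (cocompact W) := by
    rw [← subtype_coe_map_comap, tendsto_map'_iff]
    have := he.tendsto_cocompact.mono_left
      (comap_cocompact_le (continuous_subtype_val (p := (· ∈ A))))
    rwa [← hcomp] at this
  rintro u v hu hv huv ⟨p, hpA, hpu⟩ ⟨q, hqA, hqv⟩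
  by_contra hne
  have hclosure : closure (u ∩ Aᶜ) ⊆ (v ∩ Aᶜ)ᶜ :=
    closure_minimal (fun x hx hx' => hne ⟨x, hx.2, hx.1, hx'.1⟩)
      (hv.inter hA.isOpen_compl).isClosed_compl
  have hp : p ∈ u ∩ Aᶜ := ⟨hpu, hpA⟩
  refine hclosure (mem_closure_of_frontier_subset hWE hA hcont hinj hproper ?_ hp hpA hqA)
    ⟨hqv, hqA⟩
  intro x hx
  by_contra hxA
  rcases huv hxA with hxu | hxv
  · rw [(hu.inter hA.isOpen_compl).frontier_eq] at hx
    exact hx.2 ⟨hxu, hxA⟩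
  · exact hclosure (frontier_subset_closure hx) ⟨hxv, hxA⟩

theorem ne_univ_of_isClosedEmbedding {E W : Type*} [NormedAddCommGroup E]
    [InnerProductSpace ℝ E] [FiniteDimensional ℝ E]
    [NormedAddCommGroup W] [NormedSpace ℝ W] [FiniteDimensional ℝ W]
    (hWE : finrank ℝ W + 1 < finrank ℝ E) {A : Set E} {e : A → W}
    (he : IsClosedEmbedding e) : A ≠ univ := by
  rintro rfl
  have : Nontrivial E := nontrivial_of_finrank_pos (R := ℝ) (by omega)
  have hS : IsClosed (sphere (0 : E) 1) := isClosed_sphere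
  have hconn := isPreconnected_compl_of_isClosedEmbedding hWE hS
    (he.comp (.inclusion (subset_univ _) (hS.preimage continuous_subtype_val)))
  obtain ⟨y, hy⟩ := exists_norm_eq E (zero_le_two (α := ℝ))
  obtain ⟨x, -, hx1, hx2⟩ := hconn (ball 0 1) (closedBall 0 1)ᶜ isOpen_ball
    isClosed_closedBall.isOpen_compl
    (fun x hx => by
      rcases lt_trichotomy ‖x‖ 1 with h | h | h
      · exact Or.inl (by simpa using h)
      · exact absurd (by simpa using h) hx
      · exact Or.inr (by simpa using h))
    ⟨0, by simp, by simp⟩ ⟨y, by simp [hy], by simp [hy]⟩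
  exact hx2 (ball_subset_closedBall hx1)

theorem isClosed_orthant (t : ℕ) : IsClosed (orthant t) := by
  simp only [orthant, ofPred_forall]
  exact isClosed_iInter fun i => isClosed_le continuous_const (continuous_apply i)

/-- If O ⊆ ℝⁿ is closed and homeomorphic to an orthant of dimension at most n − 2,
then the complement of any closed subset O′ ⊆ O is path-connected. -/
theorem compl_closed_subset_of_orthant_pathConnected
    (n : ℕ) (hn : 1 ≤ n)
    (O : Set (EuclideanSpace ℝ (Fin n)))
    (hOclosed : IsClosed O)
    (t : ℕ) (ht : t + 2 ≤ n)
    (hhomeo : Nonempty (↥O ≃ₜ ↥(orthant t)))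
    (O' : Set (EuclideanSpace ℝ (Fin n)))
    (hO'sub : O' ⊆ O) (hO'closed : IsClosed O') :
    IsPathConnected (O'ᶜ) := by
  obtain ⟨φ⟩ := hhomeo
  have he : IsClosedEmbedding fun x : O' => (φ (inclusion hO'sub x) : Fin t → ℝ) :=
    ((isClosed_orthant t).isClosedEmbedding_subtypeVal.comp φ.isClosedEmbedding).comp
      (.inclusion hO'sub (hO'closed.preimage continuous_subtype_val))
  have hdim : finrank ℝ (Fin t → ℝ) + 1 < finrank ℝ (EuclideanSpace ℝ (Fin n)) := by
    simp only [finrank_fin_fun, finrank_euclideanSpace_fin]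
    omega
  exact hO'closed.isOpen_compl.isConnected_iff_isPathConnected.1
    ⟨nonempty_compl.2 (ne_univ_of_isClosedEmbedding hdim he),
      isPreconnected_compl_of_isClosedEmbedding hdim hO'closed he⟩
end

section
/- Let ℓ : ℝ → ℝ be a nondecreasing function with ℓ(t) ≥ 0 for all t, let T₀ > 0, α₀ > 0 and R > 0, and for each natural number j set R^j := R·(1 + 2^{−j})/2. Suppose that ℓ(R) ≤ R/(4α₀), and that for every t ∈ ℝ and every α ≥ α₀, if ℓ(t) ≥ T₀ then ℓ(t − α·ℓ(t)) ≤ ℓ(t)/2. Then for every natural number j, either ℓ(R^j) ≤ ℓ(R)/2^j, or there exists i ≤ j with ℓ(R^i) < T₀. -/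
/-- The dichotomy of Claim 4.5: either `ℓ(Rʲ) ≤ ℓ(R)/2ʲ`, or `ℓ(Rⁱ) < T₀`
for some `i ≤ j`, where `Rʲ = R(1 + 2⁻ʲ)/2`. -/
theorem ell_dichotomy
    (ℓ : ℝ → ℝ) (hmono : Monotone ℓ) (hnonneg : ∀ t, 0 ≤ ℓ t)
    (T₀ α₀ R : ℝ) (hT₀ : 0 < T₀) (hα₀ : 0 < α₀) (hR : 0 < R)
    (hsmall : ℓ R ≤ R / (4 * α₀))
    (hcontract : ∀ t α : ℝ, α₀ ≤ α → T₀ ≤ ℓ t → ℓ (t - α * ℓ t) ≤ ℓ t / 2) :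
    ∀ j : ℕ,
      ℓ (R * (1 + (2 : ℝ)⁻¹ ^ j) / 2) ≤ ℓ R / 2 ^ j ∨
      ∃ i ≤ j, ℓ (R * (1 + (2 : ℝ)⁻¹ ^ i) / 2) < T₀ := by
  intro j
  induction j with
  | zero =>
    left
    have h : R * (1 + (2 : ℝ)⁻¹ ^ 0) / 2 = R := by ring
    rw [h]
    simp
  | succ j ih =>
    rcases ih with h | ⟨i, hi, h⟩
    · by_cases hT : ℓ (R * (1 + (2 : ℝ)⁻¹ ^ j) / 2) < T₀
      · exact Or.inr ⟨j, j.le_succ, hT⟩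
      left
      rw [not_lt] at hT
      have hpos : 0 < ℓ (R * (1 + (2 : ℝ)⁻¹ ^ j) / 2) := hT₀.trans_le hT
      have hα : α₀ ≤ 2⁻¹ ^ j * R / 4 / ℓ (R * (1 + (2 : ℝ)⁻¹ ^ j) / 2) := by
        rw [le_div_iff₀ hpos]
        rw [le_div_iff₀ (by positivity)] at hsmall
        rw [div_eq_mul_inv (ℓ R), ← inv_pow] at h
        calc α₀ * ℓ (R * (1 + (2 : ℝ)⁻¹ ^ j) / 2) ≤ α₀ * (ℓ R * 2⁻¹ ^ j) := by gcongr
          _ = 2⁻¹ ^ j * (ℓ R * (4 * α₀)) / 4 := by ring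
          _ ≤ 2⁻¹ ^ j * R / 4 := by gcongr
      have hc := hcontract _ _ hα hT
      rw [div_mul_cancel₀ _ hpos.ne'] at hc
      have hstep : R * (1 + (2 : ℝ)⁻¹ ^ j) / 2 - 2⁻¹ ^ j * R / 4 =
          R * (1 + (2 : ℝ)⁻¹ ^ (j + 1)) / 2 := by
        rw [pow_succ]
        ring
      rw [hstep] at hc
      rw [pow_succ (2 : ℝ) j, ← div_div]
      linarith
    · exact Or.inr ⟨i, hi.trans j.le_succ, h⟩
end

section
/- Let ℓ : ℝ → ℝ be a nondecreasing function with ℓ(t) ≥ 0 for all t, let T₀ > 0, α₀ > 0 and R > 0. Suppose that ℓ(R) ≤ R/(4α₀), and that for every t ∈ ℝ and every α ≥ α₀, if ℓ(t) ≥ T₀ then ℓ(t − α·ℓ(t)) ≤ ℓ(t)/2. Then ℓ(R/2) < T₀. -/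
/-- The conclusion the paper extracts from Claim 4.5: under the contraction
hypothesis, `ℓ(R/2) < T₀`. -/
theorem ell_half_lt
    (ℓ : ℝ → ℝ) (hmono : Monotone ℓ) (hnonneg : ∀ t, 0 ≤ ℓ t)
    (T₀ α₀ R : ℝ) (hT₀ : 0 < T₀) (hα₀ : 0 < α₀) (hR : 0 < R)
    (hsmall : ℓ R ≤ R / (4 * α₀))
    (hcontract : ∀ t α : ℝ, α₀ ≤ α → T₀ ≤ ℓ t → ℓ (t - α * ℓ t) ≤ ℓ t / 2) :
    ℓ (R / 2) < T₀ := by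
  by_contra! hT
  have hsmall' : α₀ * ℓ R ≤ R / 4 := by
    rw [le_div_iff₀ (by positivity)] at hsmall
    linarith
  have hdecay : ∀ n : ℕ, ℓ (R * (1 + (1 / 2) ^ n) / 2) ≤ ℓ R * (1 / 2) ^ n := by
    intro n
    induction n with
    | zero => norm_num
    | succ n ih =>
      set t := R * (1 + (1 / 2) ^ n) / 2 with ht
      have hp : (0 : ℝ) < (1 / 2) ^ n := by positivity
      have hRt : R / 2 ≤ t := by
        have := mul_pos hR hp
        linarith
      have hstep : R * (1 + (1 / 2) ^ (n + 1)) / 2 ≤ t - α₀ * ℓ t := by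
        have h₁ := mul_le_mul_of_nonneg_left ih hα₀.le
        have h₂ := mul_le_mul_of_nonneg_right hsmall' hp.le
        rw [pow_succ]
        linarith
      calc ℓ (R * (1 + (1 / 2) ^ (n + 1)) / 2) ≤ ℓ (t - α₀ * ℓ t) := hmono hstep
        _ ≤ ℓ t / 2 := hcontract t α₀ le_rfl (hT.trans (hmono hRt))
        _ ≤ ℓ R * (1 / 2) ^ (n + 1) := by
          rw [pow_succ]
          linarith
  have hlim : Filter.Tendsto (fun n : ℕ => ℓ R * (1 / 2 : ℝ) ^ n) Filter.atTop (nhds 0) := by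
    simpa using (tendsto_pow_atTop_nhds_zero_of_lt_one (r := (1 / 2 : ℝ))
      (by norm_num) (by norm_num)).const_mul (ℓ R)
  obtain ⟨n, hn⟩ := (hlim.eventually_lt_const hT₀).exists
  have hle : R / 2 ≤ R * (1 + (1 / 2) ^ n) / 2 := by
    have : 0 < R * (1 / 2) ^ n := by positivity
    linarith
  linarith [hmono hle, hdecay n]
end
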